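/- (Theorem 1.2, stability for the left half-line and negative time) Let c > 0 and let Q̃_c(s) = (3c/2) · sech²(√c·s/2). There exist constants α₀, C₀, L₀ > 0 such that for all 0 < α < α₀ and all L > L₀ the following holds. Let u be a smooth decaying solution of KdV on the left half-line over (−∞,0] satisfying u(0,t) = 0 for all t ≤ 0 and the initial closeness ( ∫_{−∞}^0 ( (u(x,0) − Q̃_c(x+L))² + (∂_x u(x,0) − Q̃_c'(x+L))² ) dx )^{1/2} < α. Then there exists a continuously differentiable function ρ : (−∞,0] → ℝ such that sup_{t ≤ 0} ( ∫_{−∞}^0 ( (u(x,t) − Q̃_c(x−ρ(t)+L))² + (∂_x u(x,t) − Q̃_c'(x−ρ(t)+L))² ) dx )^{1/2} < C₀·(α + e^{−√c·L}), and there exists a constant C > 0, depending only on c, such that sup_{t ≤ 0} |ρ'(t) − c| < C·C₀·(α + e^{−√c·L}). -/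

import Mathlib

open MeasureTheory Set Filter

/-- A smooth decaying solution of KdV `∂_t u + ∂_x(∂_x² u + u²) = 0` on the left
half-line `(-∞,0]`, over a time interval `I`: smooth, satisfying the equation for
`x ≤ 0`, `t ∈ I`, with `u(·,t)` and its `x`-derivatives up to order three
integrable and square integrable on `(-∞,0)` and tending to `0` as `x → -∞`,
these bounds being locally uniform in `t`. -/
structure LeftKdVSolution (u : ℝ → ℝ → ℝ) (I : Set ℝ) : Prop where
  smooth : ContDiff ℝ (⊤ : ℕ∞) (Function.uncurry u)
  eqn : ∀ x ∈ Iic (0 : ℝ), ∀ t ∈ I,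
    deriv (fun s => u x s) t
      + deriv (fun y => iteratedDeriv 2 (fun z => u z t) y + (u y t) ^ 2) x = 0
  decay : ∀ t ∈ I, ∀ n ≤ 3,
    Tendsto (fun x => iteratedDeriv n (fun z => u z t) x) atBot (nhds 0)
  int1 : ∀ t ∈ I, ∀ n ≤ 3,
    IntegrableOn (fun x => iteratedDeriv n (fun z => u z t) x) (Iio 0)
  int2 : ∀ t ∈ I, ∀ n ≤ 3,
    IntegrableOn (fun x => (iteratedDeriv n (fun z => u z t) x) ^ 2) (Iio 0)
  locUnif : ∀ t ∈ I, ∃ ε > 0, ∃ g : ℝ → ℝ, IntegrableOn g (Iio 0) ∧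
    ∀ s ∈ I, |s - t| < ε → ∀ x ∈ Iio (0 : ℝ), ∀ n ≤ 3,
      |iteratedDeriv n (fun z => u z s) x| + (iteratedDeriv n (fun z => u z s) x) ^ 2 ≤ g x

/-- The KdV soliton profile `Q̃_c(s) = (3c/2) sech²(√c s / 2)`. -/
noncomputable def Qsol (c s : ℝ) : ℝ :=
  (3 * c / 2) * (1 / Real.cosh (Real.sqrt c * s / 2)) ^ 2



/-- derivative of the soliton profile -/
noncomputable def qd (c s : ℝ) : ℝ :=
  -(Real.sqrt c) * Real.tanh (Real.sqrt c * s / 2) * Qsol c s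

theorem sq_c {c : ℝ} (hc : 0 < c) : Real.sqrt c * Real.sqrt c = c := Real.mul_self_sqrt hc.le

theorem Qsol_pos {c : ℝ} (hc : 0 < c) (s : ℝ) : 0 < Qsol c s := by
  unfold Qsol
  have := Real.cosh_pos (Real.sqrt c * s / 2)
  positivity

theorem Qsol_hasDerivAt {c : ℝ} (s : ℝ) : HasDerivAt (Qsol c) (qd c s) s := by
  have hz : HasDerivAt (fun s : ℝ => Real.sqrt c * s / 2) (Real.sqrt c / 2) s := by
    have := ((hasDerivAt_id s).const_mul (Real.sqrt c)).div_const 2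
    simpa using this
  have hch := hz.cosh
  have hpos := Real.cosh_pos (Real.sqrt c * s / 2)
  have h1 := ((((hasDerivAt_const s (1:ℝ)).div hch hpos.ne').pow 2).const_mul (3*c/2))
  unfold Qsol
  refine h1.congr_deriv ?_
  unfold qd Qsol
  rw [Real.tanh_eq_sinh_div_cosh]
  simp
  field_simp
  try ring

theorem qd_hasDerivAt {c : ℝ} (hc : 0 < c) (s : ℝ) :
    HasDerivAt (qd c) (c * Qsol c s - Qsol c s ^ 2) s := by
  have hz : HasDerivAt (fun s : ℝ => Real.sqrt c * s / 2) (Real.sqrt c / 2) s := by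
    have := ((hasDerivAt_id s).const_mul (Real.sqrt c)).div_const 2
    simpa using this
  have hch := hz.cosh
  have hsh := hz.sinh
  have hpos := Real.cosh_pos (Real.sqrt c * s / 2)
  have hk := sq_c hc
  have hcs := Real.cosh_sq (Real.sqrt c * s / 2)
  have h1 := (((hsh.div hch hpos.ne').const_mul (-(Real.sqrt c))).mul (Qsol_hasDerivAt (c := c) s))
  have e : qd c = fun s => -(Real.sqrt c) * (Real.sinh (Real.sqrt c * s / 2) / Real.cosh (Real.sqrt c * s / 2)) * Qsol c s := by
    funext s; unfold qd; rw [Real.tanh_eq_sinh_div_cosh]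
  rw [e]
  refine h1.congr_deriv ?_
  unfold qd Qsol
  rw [Real.tanh_eq_sinh_div_cosh]
  set S := Real.sinh (Real.sqrt c * s / 2)
  set C := Real.cosh (Real.sqrt c * s / 2)
  set k := Real.sqrt c
  have hS : S ^ 2 = C ^ 2 - 1 := by linarith
  rw [show ((fun x => Real.sinh (k * x / 2)) / fun x => Real.cosh (k * x / 2)) s = S / C from rfl]
  field_simp
  rw [← hk]
  ring_nf
  simp only [hS]
  ring

theorem Qsol_even (c s : ℝ) : Qsol c (-s) = Qsol c s := by
  unfold Qsol
  rw [show Real.sqrt c * -s / 2 = -(Real.sqrt c * s / 2) by ring, Real.cosh_neg]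

theorem qd_odd (c s : ℝ) : qd c (-s) = - qd c s := by
  unfold qd
  rw [show Real.sqrt c * -s / 2 = -(Real.sqrt c * s / 2) by ring, Real.tanh_neg, Qsol_even]
  ring

theorem Qsol_zero {c : ℝ} : Qsol c 0 = 3 * c / 2 := by
  unfold Qsol; simp

theorem qd_zero {c : ℝ} : qd c 0 = 0 := by
  unfold qd; simp

theorem Qsol_le {c : ℝ} (hc : 0 < c) (s : ℝ) : Qsol c s ≤ 3 * c / 2 := by
  unfold Qsol
  have h1 := Real.one_le_cosh (Real.sqrt c * s / 2)
  have : (1 / Real.cosh (Real.sqrt c * s / 2)) ^ 2 ≤ 1 := by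
    apply pow_le_one₀ (by positivity)
    rw [div_le_one (by linarith)]; exact h1
  nlinarith

theorem qd_abs_le {c : ℝ} (hc : 0 < c) (s : ℝ) : |qd c s| ≤ Real.sqrt c * Qsol c s := by
  unfold qd
  rw [abs_mul, abs_mul, abs_neg, abs_of_pos (Qsol_pos hc s), abs_of_nonneg (Real.sqrt_nonneg c)]
  have := (Real.abs_tanh_lt_one (Real.sqrt c * s / 2)).le
  have h2 := Qsol_pos hc s
  have h3 := Real.sqrt_nonneg c
  gcongr
  nlinarith

theorem qdd_abs_le {c : ℝ} (hc : 0 < c) (s : ℝ) : |c * Qsol c s - Qsol c s ^ 2| ≤ c * Qsol c s := by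
  have h1 := Qsol_pos hc s
  have h2 := Qsol_le hc s
  rw [abs_le]; constructor <;> nlinarith

theorem tanh_pos' {x : ℝ} (hx : 0 < x) : 0 < Real.tanh x := by
  rw [Real.tanh_eq_sinh_div_cosh]
  exact div_pos (Real.sinh_pos_iff.2 hx) (Real.cosh_pos x)

theorem qd_neg {c : ℝ} (hc : 0 < c) {s : ℝ} (hs : 0 < s) : qd c s < 0 := by
  unfold qd
  have hk : 0 < Real.sqrt c := Real.sqrt_pos.2 hc
  have h1 := Qsol_pos hc s
  have := tanh_pos' (x := Real.sqrt c * s / 2) (by positivity)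
  have : 0 < Real.sqrt c * Real.tanh (Real.sqrt c * s / 2) * Qsol c s := by positivity
  linarith

theorem qd_sq {c : ℝ} (hc : 0 < c) (s : ℝ) :
    qd c s ^ 2 = c * Qsol c s ^ 2 - 2 / 3 * Qsol c s ^ 3 := by
  unfold qd Qsol
  rw [Real.tanh_eq_sinh_div_cosh]
  have hpos := Real.cosh_pos (Real.sqrt c * s / 2)
  have hk := sq_c hc
  have hcs := Real.cosh_sq (Real.sqrt c * s / 2)
  set S := Real.sinh (Real.sqrt c * s / 2)
  set C := Real.cosh (Real.sqrt c * s / 2)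
  set k := Real.sqrt c
  have hS : S ^ 2 = C ^ 2 - 1 := by linarith
  field_simp
  rw [← hk]
  ring_nf
  try simp only [hS]
  try ring

theorem Qsol_exp {c : ℝ} (hc : 0 < c) (s : ℝ) :
    Qsol c s ≤ 6 * c * Real.exp (-(Real.sqrt c * |s|)) := by
  unfold Qsol
  set z := Real.sqrt c * s / 2 with hz
  have hz2 : Real.sqrt c * |s| = 2 * |z| := by
    rw [hz, abs_div, abs_mul, abs_of_nonneg (Real.sqrt_nonneg c)]; norm_num; ring
  have h1 : Real.exp |z| / 2 ≤ Real.cosh z := by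
    rw [← Real.cosh_abs, Real.cosh_eq]
    have := Real.exp_pos (-|z|)
    linarith
  have h2 : (1 / Real.cosh z) ^ 2 ≤ (2 / Real.exp |z|) ^ 2 := by
    apply pow_le_pow_left₀ (by have := Real.cosh_pos z; positivity)
    rw [div_le_div_iff₀ (Real.cosh_pos z) (Real.exp_pos _)]
    linarith
  have h3 : (2 / Real.exp |z|) ^ 2 = 4 * Real.exp (-(2 * |z|)) := by
    rw [Real.exp_neg, two_mul, Real.exp_add]
    field_simp; norm_num
  rw [hz2]
  rw [h3] at h2
  nlinarith [hc]

theorem Qsol_deriv {c : ℝ} : deriv (Qsol c) = qd c := by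
  funext s; exact (Qsol_hasDerivAt s).deriv

theorem Qsol_cont {c : ℝ} : Continuous (Qsol c) :=
  continuous_iff_continuousAt.2 fun s => (Qsol_hasDerivAt s).continuousAt

theorem qd_cont {c : ℝ} (hc : 0 < c) : Continuous (qd c) :=
  continuous_iff_continuousAt.2 fun s => (qd_hasDerivAt hc s).continuousAt

theorem Qsol_strictAnti {c : ℝ} (hc : 0 < c) : StrictAntiOn (Qsol c) (Ici 0) := by
  apply strictAntiOn_of_deriv_neg (convex_Ici 0) Qsol_cont.continuousOn
  intro x hx
  rw [interior_Ici] at hx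
  rw [Qsol_deriv]; exact qd_neg hc hx

theorem Qsol_abs (c s : ℝ) : Qsol c |s| = Qsol c s := by
  rcases abs_cases s with ⟨h, _⟩ | ⟨h, _⟩ <;> rw [h]
  exact Qsol_even c s

/-- exponential weight -/
theorem exp_abs_integrable {k : ℝ} (hk : 0 < k) :
    Integrable (fun x : ℝ => Real.exp (-(k * |x|))) := by
  have h : IntegrableOn (fun x : ℝ => Real.exp (-k * x)) (Ioi 0) := exp_neg_integrableOn_Ioi 0 hk
  have h1 : IntegrableOn (fun x : ℝ => Real.exp (-(k * |x|))) (Ioi 0) := by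
    refine h.congr_fun (fun x hx => ?_) measurableSet_Ioi
    simp only [abs_of_pos (show (0:ℝ) < x from hx), neg_mul]
  have h2 : IntegrableOn (fun x : ℝ => Real.exp (-(k * |x|))) (Iic 0) := by
    rw [← Measure.map_neg_eq_self (volume : Measure ℝ)]
    let m : MeasurableEmbedding fun x : ℝ => -x := (Homeomorph.neg ℝ).measurableEmbedding
    rw [m.integrableOn_map_iff]
    simp_rw [Function.comp_def, abs_neg, neg_preimage, neg_Iic, neg_zero]
    exact Iff.mpr integrableOn_Ici_iff_integrableOn_Ioi h1
  have := h2.union h1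
  rwa [Iic_union_Ioi, integrableOn_univ] at this

/-- continuous functions with exponential decay -/
structure ExpDec (f : ℝ → ℝ) : Prop where
  cont : Continuous f
  bd : ∃ K k : ℝ, 0 ≤ K ∧ 0 < k ∧ ∀ x, |f x| ≤ K * Real.exp (-(k * |x|))

theorem ExpDec.memLp {f : ℝ → ℝ} (h : ExpDec f) : MemLp f 2 := by
  obtain ⟨K, k, hK, hk, hb⟩ := h.bd
  rw [memLp_two_iff_integrable_sq h.cont.aestronglyMeasurable]
  have h1 : Integrable (fun x : ℝ => K ^ 2 * Real.exp (-((2 * k) * |x|))) :=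
    (exp_abs_integrable (by positivity : 0 < 2 * k)).const_mul _
  refine h1.mono' (h.cont.pow 2).aestronglyMeasurable (ae_of_all _ fun x => ?_)
  rw [Real.norm_eq_abs, abs_of_nonneg (sq_nonneg _), ← sq_abs]
  have : Real.exp (-((2 * k) * |x|)) = Real.exp (-(k * |x|)) ^ 2 := by
    rw [← Real.exp_nat_mul]; congr 1; push_cast; ring
  rw [this, ← mul_pow]
  exact pow_le_pow_left₀ (abs_nonneg _) (hb x) 2

theorem ExpDec.tendsto {f : ℝ → ℝ} (h : ExpDec f) {l : Filter ℝ}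
    (hl : Tendsto (fun x : ℝ => |x|) l atTop) : Tendsto f l (nhds 0) := by
  obtain ⟨K, k, hK, hk, hb⟩ := h.bd
  refine squeeze_zero_norm (a := fun x => K * Real.exp (-(k * |x|))) (fun x => hb x) ?_
  have h2 : Tendsto (fun x : ℝ => k * |x|) l atTop := hl.const_mul_atTop hk
  have := (Real.tendsto_exp_neg_atTop_nhds_zero.comp h2).const_mul K
  simpa using this

theorem ExpDec.top {f : ℝ → ℝ} (h : ExpDec f) : Tendsto f atTop (nhds 0) :=
  h.tendsto tendsto_abs_atTop_atTop

theorem ExpDec.bot {f : ℝ → ℝ} (h : ExpDec f) : Tendsto f atBot (nhds 0) :=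
  h.tendsto tendsto_abs_atBot_atTop

theorem ExpDec.of_Q {c : ℝ} (hc : 0 < c) {f : ℝ → ℝ} (hf : Continuous f) (A B : ℝ)
    (hA : 0 ≤ A) (hB : 0 ≤ B)
    (h : ∀ x, |f x| ≤ (A + B * |x|) * Qsol c x) : ExpDec f := by
  have hk : 0 < Real.sqrt c := Real.sqrt_pos.2 hc
  refine ⟨hf, (A + B * (2 / Real.sqrt c)) * (6 * c), Real.sqrt c / 2, by positivity, by positivity,
    fun x => ?_⟩
  set k := Real.sqrt c
  have h1 := Qsol_exp hc x
  have h2 : Real.exp (-(k * |x|)) = Real.exp (-(k / 2 * |x|)) * Real.exp (-(k / 2 * |x|)) := by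
    rw [← Real.exp_add]; congr 1; ring
  have h3 : (A + B * |x|) * Real.exp (-(k / 2 * |x|)) ≤ A + B * (2 / k) := by
    have e1 : Real.exp (-(k / 2 * |x|)) ≤ 1 := by
      apply Real.exp_le_one_iff.2
      have := abs_nonneg x
      have : 0 ≤ k / 2 * |x| := by positivity
      linarith
    have e2 : |x| * Real.exp (-(k / 2 * |x|)) ≤ 2 / k := by
      have e3 := Real.add_one_le_exp (k / 2 * |x|)
      rw [Real.exp_neg]
      have := Real.exp_pos (k / 2 * |x|)
      rw [← div_eq_mul_inv, div_le_div_iff₀ this hk]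
      nlinarith
    have e4 := Real.exp_pos (-(k / 2 * |x|))
    nlinarith
  calc |f x| ≤ (A + B * |x|) * Qsol c x := h x
    _ ≤ (A + B * |x|) * (6 * c * Real.exp (-(k * |x|))) := by
        gcongr
    _ = ((A + B * |x|) * Real.exp (-(k / 2 * |x|))) * (6 * c) * Real.exp (-(k / 2 * |x|)) := by
        rw [h2]; ring
    _ ≤ _ := by gcongr

theorem Q_dec {c : ℝ} (hc : 0 < c) : ExpDec (Qsol c) :=
  ExpDec.of_Q hc Qsol_cont 1 0 (by norm_num) le_rfl fun x => by
    rw [abs_of_pos (Qsol_pos hc x)]; simp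

theorem qd_dec {c : ℝ} (hc : 0 < c) : ExpDec (qd c) :=
  ExpDec.of_Q hc (qd_cont hc) (Real.sqrt c) 0 (Real.sqrt_nonneg c) le_rfl fun x => by
    simpa using qd_abs_le hc x

theorem qdd_dec {c : ℝ} (hc : 0 < c) : ExpDec (fun x => c * Qsol c x - Qsol c x ^ 2) :=
  ExpDec.of_Q hc ((Qsol_cont.const_mul c).sub (Qsol_cont.pow 2)) c 0 hc.le le_rfl fun x => by
    simpa using qdd_abs_le hc x

/-- the derivative of the profile with respect to the speed -/
noncomputable def Rf (c s : ℝ) : ℝ := (Qsol c s + s * qd c s / 2) / c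

noncomputable def Rd (c s : ℝ) : ℝ := (3 / 2 * qd c s + s * (c * Qsol c s - Qsol c s ^ 2) / 2) / c

theorem Rf_hasDerivAt {c : ℝ} (hc : 0 < c) (s : ℝ) : HasDerivAt (Rf c) (Rd c s) s := by
  have h := ((Qsol_hasDerivAt (c := c) s).add
    (((hasDerivAt_id s).mul (qd_hasDerivAt hc s)).div_const 2)).div_const c
  refine h.congr_deriv ?_
  simp [Rd]; ring

theorem Rd_hasDerivAt {c : ℝ} (hc : 0 < c) (s : ℝ) :
    HasDerivAt (Rd c) ((c - 2 * Qsol c s) * Rf c s + Qsol c s) s := by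
  have hq := Qsol_hasDerivAt (c := c) s
  have h := (((qd_hasDerivAt hc s).const_mul (3/2)).add
    (((hasDerivAt_id s).mul ((hq.const_mul c).sub (hq.pow 2))).div_const 2)).div_const c
  refine h.congr_deriv ?_
  simp [Rf]; field_simp; ring

theorem Rf_dec {c : ℝ} (hc : 0 < c) : ExpDec (Rf c) := by
  refine ExpDec.of_Q hc (continuous_iff_continuousAt.2 fun s => (Rf_hasDerivAt hc s).continuousAt)
    (1 / c) (Real.sqrt c / 2 / c) (by positivity) (by positivity) fun x => ?_
  unfold Rf
  have h1 := qd_abs_le hc x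
  have h2 := Qsol_pos hc x
  rw [abs_div, abs_of_pos hc, div_le_iff₀ hc]
  calc |Qsol c x + x * qd c x / 2| ≤ |Qsol c x| + |x * qd c x / 2| := abs_add_le _ _
    _ = Qsol c x + |x| * |qd c x| / 2 := by
      rw [abs_of_pos h2, abs_div, abs_mul]; norm_num
    _ ≤ Qsol c x + |x| * (Real.sqrt c * Qsol c x) / 2 := by gcongr
    _ = _ := by field_simp

theorem Rd_dec {c : ℝ} (hc : 0 < c) : ExpDec (Rd c) := by
  refine ExpDec.of_Q hc (continuous_iff_continuousAt.2 fun s => (Rd_hasDerivAt hc s).continuousAt)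
    (3 / 2 * Real.sqrt c / c) (1 / 2) (by positivity) (by positivity) fun x => ?_
  unfold Rd
  have h1 := qd_abs_le hc x
  have h3 := qdd_abs_le hc x
  have h2 := Qsol_pos hc x
  rw [abs_div, abs_of_pos hc, div_le_iff₀ hc]
  calc |3 / 2 * qd c x + x * (c * Qsol c x - Qsol c x ^ 2) / 2|
      ≤ |3 / 2 * qd c x| + |x * (c * Qsol c x - Qsol c x ^ 2) / 2| := abs_add_le _ _
    _ = 3 / 2 * |qd c x| + |x| * |c * Qsol c x - Qsol c x ^ 2| / 2 := by
      rw [abs_mul (3 / 2 : ℝ), abs_div (x * _) 2, abs_mul x]; norm_num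
    _ ≤ 3 / 2 * (Real.sqrt c * Qsol c x) + |x| * (c * Qsol c x) / 2 := by gcongr
    _ = _ := by field_simp

theorem Rf_zero {c : ℝ} (hc : 0 < c) : Rf c 0 = 3 / 2 := by
  unfold Rf; rw [Qsol_zero]; field_simp; simp

theorem Rd_zero {c : ℝ} : Rd c 0 = 0 := by
  unfold Rd; rw [qd_zero]; simp

theorem Rf_even (c s : ℝ) : Rf c (-s) = Rf c s := by
  unfold Rf; rw [Qsol_even, qd_odd]; ring

/-- fundamental theorem of calculus on a right half-line with one exceptional point -/
theorem ftc_Ioi {F F' : ℝ → ℝ} {a z : ℝ} (hF : ContinuousOn F (Ici a))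
    (hd : ∀ x, a < x → x ≠ z → HasDerivAt F (F' x) x) (hi : IntegrableOn F' (Ioi a))
    (ht : Tendsto F atTop (nhds 0)) : ∫ x in Ioi a, F' x = - F a := by
  have h1 := intervalIntegral_tendsto_integral_Ioi a hi tendsto_id
  have h2 : Tendsto (fun b => F b - F a) atTop (nhds (0 - F a)) := ht.sub_const _
  rw [zero_sub] at h2
  refine tendsto_nhds_unique h1 (h2.congr' ?_)
  filter_upwards [eventually_ge_atTop a] with b hb
  symm
  refine integral_eq_of_hasDerivAt_off_countable_of_le F F' hb (countable_singleton z)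
    (hF.mono Icc_subset_Ici_self) (fun x hx => hd x hx.1.1 hx.2) ?_
  show IntervalIntegrable F' volume a b
  rw [intervalIntegrable_iff_integrableOn_Ioc_of_le hb]
  exact hi.mono_set Ioc_subset_Ioi_self

/-- fundamental theorem of calculus on the line with one exceptional point -/
theorem ftc_line {F F' : ℝ → ℝ} {z : ℝ} (hF : Continuous F)
    (hd : ∀ x, x ≠ z → HasDerivAt F (F' x) x) (hi : Integrable F')
    (ht : Tendsto F atTop (nhds 0)) (hb : Tendsto F atBot (nhds 0)) : ∫ x, F' x = 0 := by
  have h1 := intervalIntegral_tendsto_integral hi tendsto_neg_atTop_atBot tendsto_id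
  have h2 : Tendsto (fun b => F b - F (-b)) atTop (nhds (0 - 0)) :=
    ht.sub (hb.comp tendsto_neg_atTop_atBot)
  rw [sub_zero] at h2
  refine tendsto_nhds_unique h1 (h2.congr' ?_)
  filter_upwards [eventually_ge_atTop 0] with b hb
  symm
  refine integral_eq_of_hasDerivAt_off_countable F F' (countable_singleton z)
    hF.continuousOn (fun x hx => hd x hx.2) hi.intervalIntegrable


theorem Iadd {μ : Measure ℝ} {f g : ℝ → ℝ} (hf : Integrable f μ) (hg : Integrable g μ) :
    Integrable (fun x => f x + g x) μ := hf.add hg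

theorem Isub {μ : Measure ℝ} {f g : ℝ → ℝ} (hf : Integrable f μ) (hg : Integrable g μ) :
    Integrable (fun x => f x - g x) μ := hf.sub hg

theorem p_lower {c : ℝ} (hc : 0 < c) {x : ℝ} (hx : 0 < x) :
    -Real.sqrt c ≤ (c * Qsol c x - Qsol c x ^ 2) / qd c x := by
  have hq := qd_neg hc hx
  have hQ := Qsol_pos hc x
  have hs := qd_sq hc x
  have hk : 0 < Real.sqrt c := Real.sqrt_pos.2 hc
  have hkk := sq_c hc
  rw [le_div_iff_of_neg hq]
  set Q := Qsol c x
  set q := qd c x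
  rcases le_or_gt c Q with h | h
  · nlinarith
  · have h1 : (c * Q - Q ^ 2) ^ 2 ≤ (-Real.sqrt c * q) ^ 2 := by
      have : (-Real.sqrt c * q) ^ 2 = c * (c * Q ^ 2 - 2 / 3 * Q ^ 3) := by
        rw [mul_pow, neg_sq, hs, sq, hkk]
      rw [this]
      have : 0 ≤ Q ^ 3 * (4 / 3 * c - Q) := by
        apply mul_nonneg (by positivity); linarith
      nlinarith
    exact abs_le_of_sq_le_sq' h1 (by nlinarith) |>.2

theorem f2q_cont {c : ℝ} (hc : 0 < c) {f : ℝ → ℝ} {d : ℝ} (hf : HasDerivAt f d 0) (h0 : f 0 = 0) :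
    ContinuousAt (fun x => f x ^ 2 / qd c x) 0 := by
  rw [continuousAt_iff_punctured_nhds]
  have h1 := hf.tendsto_slope
  have h2 := (qd_hasDerivAt hc 0).tendsto_slope
  have h3 : Tendsto f (nhdsWithin 0 {0}ᶜ) (nhds 0) := by
    have := hf.continuousAt.tendsto
    rw [h0] at this
    exact this.mono_left nhdsWithin_le_nhds
  have hne : c * Qsol c 0 - Qsol c 0 ^ 2 ≠ 0 := by
    rw [Qsol_zero]
    have : c * (3 * c / 2) - (3 * c / 2) ^ 2 = -(3/4) * c ^ 2 := by ring
    rw [this]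
    have := hc.ne'
    simp [this]
  have h4 := (h3.mul h1).div h2 hne
  simp only [h0, zero_mul, zero_div, qd_zero, div_zero] at h4 ⊢
  have e : (0:ℝ) ^ 2 / 0 = 0 := by simp
  try rw [e]
  refine h4.congr' ?_
  filter_upwards [self_mem_nhdsWithin] with x hx
  have hx : x ≠ 0 := hx
  simp only [Pi.div_apply, slope_def_field, h0, qd_zero, sub_zero]
  rcases eq_or_ne (qd c x) 0 with h | h
  · simp [h]
  · field_simp

theorem inner_form {c : ℝ} (hc : 0 < c) {a : ℝ} (ha : 0 < a) :
    ∃ κ : ℝ, 0 < κ ∧ ∀ f f' : ℝ → ℝ, (∀ x ∈ Icc 0 a, HasDerivAt f (f' x) x) → f 0 = 0 → f a = 0 →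
      IntegrableOn (fun x => f' x ^ 2) (Icc 0 a) →
      κ * ∫ x in Icc 0 a, f x ^ 2 ≤ ∫ x in Icc 0 a, (f' x ^ 2 + (c - 2 * Qsol c x) * f x ^ 2) := by
  set lam := 2 * Real.sqrt c + 2 with hl
  have hk : 0 < Real.sqrt c := Real.sqrt_pos.2 hc
  set β := Real.exp (-(lam * a)) with hβ
  have hβ0 : 0 < β := Real.exp_pos _
  refine ⟨β, hβ0, fun f f' hd h0 h1 hi => ?_⟩
  have hfc : ContinuousOn f (Icc 0 a) := fun x hx => (hd x hx).continuousAt.continuousWithinAt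
  have hif : IntegrableOn (fun x => f x ^ 2) (Icc 0 a) := (hfc.pow 2).integrableOn_Icc
  have hiq : IntegrableOn (fun x => (c - 2 * Qsol c x) * f x ^ 2) (Icc 0 a) := by
    apply ContinuousOn.integrableOn_Icc
    exact (continuous_const.sub (continuous_const.mul Qsol_cont)).continuousOn.mul (hfc.pow 2)
  set G : ℝ → ℝ := fun x => (c * Qsol c x - Qsol c x ^ 2) * (f x ^ 2 / qd c x)
    + (-β * Real.exp (lam * x)) * f x ^ 2 with hG
  have key := intervalIntegral.sub_le_integral_of_hasDeriv_right_of_le (a := 0) (b := a) ha.le (g := G)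
    (g' := fun x => ((c - 2 * Qsol c x) - ((c * Qsol c x - Qsol c x ^ 2) / qd c x) ^ 2
        - lam * β * Real.exp (lam * x)) * f x ^ 2
      + ((c * Qsol c x - Qsol c x ^ 2) / qd c x - β * Real.exp (lam * x)) * (2 * f x * f' x))
    (φ := fun x => f' x ^ 2 + (c - 2 * Qsol c x) * f x ^ 2 - β * f x ^ 2) ?_ ?_ ?_ ?_
  · have e0 : G 0 = 0 := by simp [hG, h0]
    have e1 : G a = 0 := by simp [hG, h1]
    rw [e0, e1, intervalIntegral.integral_of_le ha.le, ← integral_Icc_eq_integral_Ioc] at key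
    rw [integral_sub (Iadd hi hiq) (hif.const_mul β), integral_const_mul] at key
    linarith
  · intro x hx
    rcases hx.1.eq_or_lt with h | h
    · subst h
      apply ContinuousAt.continuousWithinAt
      have A := f2q_cont hc (hd 0 hx) h0
      have B : ContinuousAt (fun x => c * Qsol c x - Qsol c x ^ 2) 0 :=
        ((Qsol_cont.const_mul c).sub (Qsol_cont.pow 2)).continuousAt
      have D : ContinuousAt (fun x => -β * Real.exp (lam * x)) 0 := by fun_prop
      exact (B.mul A).add (D.mul ((hd 0 hx).continuousAt.pow 2))
    · apply ContinuousAt.continuousWithinAt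
      have B : ContinuousAt (fun x => c * Qsol c x - Qsol c x ^ 2) x :=
        ((Qsol_cont.const_mul c).sub (Qsol_cont.pow 2)).continuousAt
      have D : ContinuousAt (fun x => -β * Real.exp (lam * x)) x := by fun_prop
      have A := ((hd x hx).continuousAt.pow 2).div (qd_cont hc).continuousAt (qd_neg hc h).ne
      exact (B.mul A).add (D.mul ((hd x hx).continuousAt.pow 2))
  · intro x hx
    apply HasDerivAt.hasDerivWithinAt
    have hq := (qd_neg hc hx.1).ne
    have hdx := hd x ⟨hx.1.le, hx.2.le⟩
    have B := ((Qsol_hasDerivAt (c := c) x).const_mul c).sub ((Qsol_hasDerivAt (c := c) x).pow 2)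
    have A := (hdx.pow 2).div (qd_hasDerivAt hc x) hq
    have D : HasDerivAt (fun x => -β * Real.exp (lam * x)) (-β * (Real.exp (lam * x) * lam)) x := by
      have := (((hasDerivAt_id x).const_mul lam).exp).const_mul (-β)
      simpa using this
    refine ((B.mul A).add (D.mul (hdx.pow 2))).congr_deriv ?_
    simp only [Pi.pow_apply, Pi.sub_apply, Pi.div_apply]
    field_simp
    ring
  · exact (hi.add hiq).sub (hif.const_mul β)
  · intro x hx
    have hp := p_lower hc hx.1
    set p := (c * Qsol c x - Qsol c x ^ 2) / qd c x
    set E := β * Real.exp (lam * x) with hE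
    have hE1 : β ≤ E := by
      have : 1 ≤ Real.exp (lam * x) := Real.one_le_exp (mul_nonneg (by positivity) hx.1.le)
      nlinarith
    have hE2 : E ≤ 1 := by
      rw [hE, hβ, ← Real.exp_add, Real.exp_le_one_iff]
      have : 0 < lam := by positivity
      nlinarith [hx.2]
    have e : lam * β * Real.exp (lam * x) = lam * E := by rw [hE]; ring
    rw [e]
    have h5 : 0 ≤ (f' x - (p - E) * f x) ^ 2 := sq_nonneg _
    have h6 : 0 ≤ (lam * E + 2 * p * E - E ^ 2 - β) * f x ^ 2 := by
      apply mul_nonneg _ (sq_nonneg _)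
      have : 0 ≤ (p + Real.sqrt c) * E := mul_nonneg (by linarith) (by linarith)
      rw [hl]; nlinarith
    nlinarith


theorem Imul {μ : Measure ℝ} {f g : ℝ → ℝ} (hf : MemLp f 2 μ) (hg : MemLp g 2 μ) :
    Integrable (fun x => f x * g x) μ := MemLp.integrable_mul hf hg

theorem Isq {μ : Measure ℝ} {f : ℝ → ℝ} (hf : MemLp f 2 μ) :
    Integrable (fun x => f x ^ 2) μ := hf.integrable_sq

/-- Cauchy-Schwarz -/
theorem cs_ineq {μ : Measure ℝ} {f g : ℝ → ℝ} (hf : MemLp f 2 μ) (hg : MemLp g 2 μ) :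
    (∫ x, f x * g x ∂μ) ^ 2 ≤ (∫ x, f x ^ 2 ∂μ) * ∫ x, g x ^ 2 ∂μ := by
  have h : ∀ t : ℝ, 0 ≤ (∫ x, g x ^ 2 ∂μ) * (t * t) + (2 * ∫ x, f x * g x ∂μ) * t
      + ∫ x, f x ^ 2 ∂μ := by
    intro t
    have e : (∫ x, g x ^ 2 ∂μ) * (t * t) + (2 * ∫ x, f x * g x ∂μ) * t
      + ∫ x, f x ^ 2 ∂μ = ∫ x, (f x + t * g x) ^ 2 ∂μ := by
      have h1 : ∀ x, (f x + t * g x) ^ 2 = (t * t) * g x ^ 2 + (2 * t) * (f x * g x) + f x ^ 2 :=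
        fun x => by ring
      simp only [h1]
      rw [integral_add (Iadd ((Isq hg).const_mul _) ((Imul hf hg).const_mul _)) (Isq hf),
        integral_add ((Isq hg).const_mul _) ((Imul hf hg).const_mul _), integral_const_mul,
        integral_const_mul]
      ring
    rw [e]
    exact integral_nonneg fun x => sq_nonneg _
  have := discrim_le_zero h
  unfold discrim at this
  nlinarith

/-- finite energy functions with at most one kink -/
structure HK (z : ℝ) (v v' : ℝ → ℝ) : Prop where
  cont : Continuous v
  der : ∀ x, x ≠ z → HasDerivAt v (v' x) x
  l2 : MemLp v 2
  l2' : MemLp v' 2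
  top : Tendsto v atTop (nhds 0)
  bot : Tendsto v atBot (nhds 0)

theorem HK.addE {z : ℝ} {v v' f f' : ℝ → ℝ} (h : HK z v v') (hf : ExpDec f) (hf' : ExpDec f')
    (hd : ∀ x, HasDerivAt f (f' x) x) (C : ℝ) :
    HK z (fun x => v x + C * f x) (fun x => v' x + C * f' x) where
  cont := h.cont.add (hf.cont.const_mul C)
  der x hx := (h.der x hx).add ((hd x).const_mul C)
  l2 := h.l2.add (hf.memLp.const_mul C)
  l2' := h.l2'.add (hf'.memLp.const_mul C)
  top := by simpa using h.top.add (hf.top.const_mul C)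
  bot := by simpa using h.bot.add (hf.bot.const_mul C)

theorem HK.shift {z : ℝ} {v v' : ℝ → ℝ} (h : HK z v v') (y : ℝ) :
    HK (z - y) (fun x => v (x + y)) (fun x => v' (x + y)) where
  cont := h.cont.comp (continuous_add_const y)
  der x hx := (h.der (x + y) (fun e => hx (by linarith))).comp_add_const x y
  l2 := h.l2.comp_measurePreserving (measurePreserving_add_right volume y)
  l2' := h.l2'.comp_measurePreserving (measurePreserving_add_right volume y)
  top := h.top.comp (tendsto_atTop_add_const_right _ y tendsto_id)
  bot := h.bot.comp (tendsto_atBot_add_const_right _ y tendsto_id)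

theorem HK.refl {z : ℝ} {v v' : ℝ → ℝ} (h : HK z v v') :
    HK (-z) (fun x => v (-x)) (fun x => - v' (-x)) where
  cont := h.cont.comp continuous_neg
  der x hx := by
    have := (h.der (-x) (fun e => hx (by linarith))).comp x (hasDerivAt_neg x)
    simpa [Function.comp_def] using this
  l2 := h.l2.comp_measurePreserving (Measure.measurePreserving_neg volume)
  l2' := (h.l2'.comp_measurePreserving (Measure.measurePreserving_neg volume)).neg
  top := h.bot.comp tendsto_neg_atTop_atBot
  bot := h.top.comp tendsto_neg_atBot_atTop

theorem HK.sup {z : ℝ} {v v' : ℝ → ℝ} (h : HK z v v') (x : ℝ) :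
    v x ^ 2 ≤ ∫ y, (v y ^ 2 + v' y ^ 2) := by
  have hi : Integrable (fun y => v y ^ 2 + v' y ^ 2) := Iadd (Isq h.l2) (Isq h.l2')
  have hm := Imul h.l2 h.l2'
  have k := ftc_Ioi (F := fun y => v y ^ 2) (F' := fun y => 2 * (v y * v' y)) (a := x) (z := z)
    (h.cont.pow 2).continuousOn (fun y _ hy => ((h.der y hy).pow 2).congr_deriv (by simp; ring))
    (hm.const_mul 2).integrableOn (by simpa using h.top.pow 2)
  have e : v x ^ 2 = ∫ y in Ioi x, (-(2 * (v y * v' y))) := by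
    rw [integral_neg, k]; simp
  rw [e]
  calc _ ≤ ∫ y in Ioi x, (v y ^ 2 + v' y ^ 2) := by
        apply integral_mono (hm.const_mul 2).integrableOn.neg hi.integrableOn
        intro y
        simp only [Pi.neg_apply]
        nlinarith [sq_nonneg (v y + v' y)]
    _ ≤ _ := setIntegral_le_integral hi (ae_of_all _ fun y => by positivity)

theorem IQ {c : ℝ} (hc : 0 < c) {μ : Measure ℝ} {f : ℝ → ℝ} (hf : Integrable f μ) :
    Integrable (fun x => (c - 2 * Qsol c x) * f x) μ := by
  apply hf.bdd_mul (c := 4 * c)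
  · exact (continuous_const.sub (Qsol_cont.const_mul 2)).aestronglyMeasurable
  · refine ae_of_all _ fun x => ?_
    have h1 := Qsol_pos hc x
    have h2 := Qsol_le hc x
    rw [Real.norm_eq_abs, abs_le]; constructor <;> linarith

theorem HK.form_int {c z : ℝ} (hc : 0 < c) {v v' : ℝ → ℝ} (h : HK z v v') :
    Integrable (fun x => v' x ^ 2 + (c - 2 * Qsol c x) * v x ^ 2) :=
  Iadd (Isq h.l2') (IQ hc (Isq h.l2))

theorem half_form {c : ℝ} (hc : 0 < c) {a : ℝ} (ha : 0 < a)
    (hout : ∀ x, a ≤ x → 2 * Qsol c x ≤ c / 2) :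
    ∃ κ : ℝ, 0 < κ ∧ ∀ (z : ℝ) (v v' : ℝ → ℝ), HK z v v' → (∀ x ∈ Icc 0 a, x ≠ z) →
      v 0 = 0 → v a = 0 →
      κ * ∫ x in Ioi 0, v x ^ 2 ≤ ∫ x in Ioi 0, (v' x ^ 2 + (c - 2 * Qsol c x) * v x ^ 2) := by
  obtain ⟨β, hβ, H⟩ := inner_form hc ha
  refine ⟨min β (c / 2), by positivity, fun z v v' h hz h0 h1 => ?_⟩
  have k := H v v' (fun x hx => h.der x (hz x hx)) h0 h1 (Isq h.l2').integrableOn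
  have hv := Isq h.l2
  have hf := h.form_int hc
  have hu : Ioi (0:ℝ) = Ioc 0 a ∪ Ioi a := (Ioc_union_Ioi_eq_Ioi ha.le).symm
  have hdj : Disjoint (Ioc 0 a) (Ioi a) := by
    rw [Set.disjoint_left]; intro x hx hx'; exact absurd hx.2 (not_le.2 hx')
  rw [hu, setIntegral_union hdj measurableSet_Ioi hv.integrableOn hv.integrableOn,
    setIntegral_union hdj measurableSet_Ioi hf.integrableOn hf.integrableOn]
  rw [integral_Icc_eq_integral_Ioc, integral_Icc_eq_integral_Ioc] at k
  have k2 : (c / 2) * ∫ x in Ioi a, v x ^ 2 ≤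
      ∫ x in Ioi a, (v' x ^ 2 + (c - 2 * Qsol c x) * v x ^ 2) := by
    rw [← integral_const_mul]
    apply setIntegral_mono_on (hv.const_mul _).integrableOn hf.integrableOn measurableSet_Ioi
    intro x hx
    have := hout x (le_of_lt hx)
    nlinarith [sq_nonneg (v' x), sq_nonneg (v x)]
  have p1 : 0 ≤ ∫ x in Ioc 0 a, v x ^ 2 := integral_nonneg fun x => sq_nonneg _
  have p2 : 0 ≤ ∫ x in Ioi a, v x ^ 2 := integral_nonneg fun x => sq_nonneg _
  have := min_le_left β (c / 2)
  have := min_le_right β (c / 2)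
  nlinarith

theorem half_form2 {c : ℝ} (hc : 0 < c) {x1 : ℝ} (ha : 0 < x1)
    (hout : ∀ x, x1 ≤ x → 2 * Qsol c x ≤ c / 2) :
    ∃ κ : ℝ, 0 < κ ∧ ∀ (z : ℝ) (v v' : ℝ → ℝ), HK z v v' → (∀ x ∈ Icc 0 x1, x ≠ z) →
      ∀ a b : ℝ, v 0 - b * Rf c 0 = 0 → v x1 + a * qd c x1 - b * Rf c x1 = 0 →
      κ * (∫ x in Ioi 0, (v x + a * qd c x - b * Rf c x) ^ 2)
        - 2 * b * (∫ x in Ioi 0, Qsol c x * v x) + b ^ 2 * (∫ x in Ioi 0, Qsol c x * Rf c x)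
        ≤ ∫ x in Ioi 0, (v' x ^ 2 + (c - 2 * Qsol c x) * v x ^ 2) := by
  obtain ⟨κ, hκ, H⟩ := half_form hc ha hout
  refine ⟨κ, hκ, fun z v v' h hz a b hb hab => ?_⟩
  have hr := (h.addE (qd_dec hc) (qdd_dec hc) (qd_hasDerivAt hc) a).addE (Rf_dec hc) (Rd_dec hc)
    (Rf_hasDerivAt hc) (-b)
  have k := H z _ _ hr hz (by simp only [qd_zero]; linarith) (by linarith)
  set r : ℝ → ℝ := fun x => v x + a * qd c x + -b * Rf c x with hrdef
  set r' : ℝ → ℝ := fun x => v' x + a * (c * Qsol c x - Qsol c x ^ 2) + -b * Rd c x with hr'def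
  have e1 : ∀ x, v x + a * qd c x - b * Rf c x = r x := fun x => by simp only [hrdef]; ring
  simp only [e1]
  have iv := h.form_int hc
  have ir := hr.form_int hc
  have iQv := Imul (Q_dec hc).memLp h.l2
  have iQR := Imul (Q_dec hc).memLp (Rf_dec hc).memLp
  have F := ftc_Ioi (a := 0) (z := z)
    (F := fun x => -2 * a * ((c * Qsol c x - Qsol c x ^ 2) * r x)
      + a ^ 2 * ((c * Qsol c x - Qsol c x ^ 2) * qd c x)
      + 2 * b * (Rd c x * (v x - b * Rf c x)) + b ^ 2 * (Rd c x * Rf c x))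
    (F' := fun x => (v' x ^ 2 + (c - 2 * Qsol c x) * v x ^ 2)
      - (r' x ^ 2 + (c - 2 * Qsol c x) * r x ^ 2) + (2 * b) * (Qsol c x * v x)
      - b ^ 2 * (Qsol c x * Rf c x)) ?_ ?_ ?_ ?_
  · rw [integral_sub (Iadd (Isub iv ir) (iQv.const_mul _)).integrableOn
        (iQR.const_mul _).integrableOn,
      integral_add (Isub iv ir).integrableOn (iQv.const_mul _).integrableOn,
      integral_sub iv.integrableOn ir.integrableOn, integral_const_mul, integral_const_mul] at F
    have hr0 : r 0 = 0 := by rw [← e1, qd_zero]; linarith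
    simp only [hr0, qd_zero, Rd_zero] at F
    simp only [mul_zero, zero_mul, add_zero, neg_zero] at F
    linarith
  · have := (qdd_dec hc).cont
    have := hr.cont
    have := (qd_dec hc).cont
    have := (Rd_dec hc).cont
    have := (Rf_dec hc).cont
    have := h.cont
    apply Continuous.continuousOn
    fun_prop
  · intro x _ hx
    have hQ := Qsol_hasDerivAt (c := c) x
    have hQ2 := (hQ.const_mul c).sub (hQ.pow 2)
    have hq := qd_hasDerivAt hc x
    have hR := Rf_hasDerivAt hc x
    have hRd := Rd_hasDerivAt hc x
    have hrx := hr.der x hx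
    have hvx := h.der x hx
    have := ((((hQ2.mul hrx).const_mul (-2 * a)).add ((hQ2.mul hq).const_mul (a ^ 2))).add
      ((hRd.mul (hvx.sub (hR.const_mul b))).const_mul (2 * b))).add
      ((hRd.mul hR).const_mul (b ^ 2))
    refine this.congr_deriv ?_
    simp only [Pi.sub_apply, Pi.pow_apply, hrdef, hr'def]
    push_cast
    ring
  · exact (Isub (Iadd (Isub iv ir) (iQv.const_mul _)) (iQR.const_mul _)).integrableOn
  · have t1 := (qdd_dec hc).top
    have t2 := hr.top
    have t3 := (qd_dec hc).top
    have t4 := (Rd_dec hc).top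
    have t5 := (Rf_dec hc).top
    have t6 := h.top
    have := ((((t1.mul t2).const_mul (-2 * a)).add ((t1.mul t3).const_mul (a ^ 2))).add
      ((t4.mul (t6.sub (t5.const_mul b))).const_mul (2 * b))).add
      ((t4.mul t5).const_mul (b ^ 2))
    simpa using this


theorem coer_alg {κ q T n D R2 c : ℝ} (hκ : 0 < κ) (hq : 0 < q) (hT : 0 < T) (hn : 0 ≤ n)
    (hD : 0 ≤ D) (hR : 0 ≤ R2) (hc : 0 < c) :
    ∃ K1 K2 : ℝ, 0 < K1 ∧ 0 < K2 ∧ ∀ P1 P2 a b m B s1 s2 V W : ℝ, 0 ≤ P1 → 0 ≤ P2 →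
      κ * (P1 + P2) - 2 * b * m + b ^ 2 * q ≤ B → m = s1 + s2 + a * T + b * q →
      s1 ^ 2 ≤ n * P1 → s2 ^ 2 ≤ n * P2 →
      V ≤ 3 * (P1 + P2) + D * a ^ 2 + R2 * b ^ 2 → W ≤ B + 2 * c * V →
      V + W ≤ K1 * B + K2 * m ^ 2 := by
  set α := 4 * (n / κ + 2 * q) / T ^ 2 with hα
  have hα0 : 0 < α := by positivity
  set γ := 4 / T ^ 2 with hγ
  have hγ0 : 0 < γ := by positivity
  set A1 := 3 / κ + D * α + R2 * (2 / q) with hA1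
  have hA10 : 0 < A1 := by positivity
  refine ⟨(1 + 2 * c) * A1 + 1, ((1 + 2 * c) * A1 + 1) * (2 / q) + (1 + 2 * c) * (D * γ) , by positivity,
    by positivity, ?_⟩
  intro P1 P2 a b m B s1 s2 V W hP1 hP2 h1 h2 h3 h4 h5 h6
  set X := B + 2 / q * m ^ 2 with hX
  have hXb : κ * (P1 + P2) + q / 2 * b ^ 2 ≤ X := by
    have : 0 ≤ (q / 2) * (b - 2 / q * m) ^ 2 := by positivity
    have e : (q / 2) * (b - 2 / q * m) ^ 2 = q / 2 * b ^ 2 - 2 * b * m + 2 / q * m ^ 2 := by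
      field_simp
      ring
    rw [e] at this
    rw [hX]; linarith
  have hPX : P1 + P2 ≤ X / κ := by
    rw [le_div_iff₀ hκ]; nlinarith [sq_nonneg b]
  have hbX : b ^ 2 ≤ 2 / q * X := by
    rw [div_mul_eq_mul_div, le_div_iff₀ hq]
    nlinarith [mul_nonneg hκ.le (add_nonneg hP1 hP2)]
  have hX0 : 0 ≤ X := by
    have : 0 ≤ κ * (P1 + P2) + q / 2 * b ^ 2 := by positivity
    linarith
  have ha : a ^ 2 ≤ γ * m ^ 2 + α * X := by
    have e : a * T = m - s1 - s2 - b * q := by linarith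
    have h7 : (a * T) ^ 2 ≤ 4 * (m ^ 2 + s1 ^ 2 + s2 ^ 2 + (b * q) ^ 2) := by
      rw [e]
      nlinarith [sq_nonneg (m + s1), sq_nonneg (m + s2), sq_nonneg (m + b * q),
        sq_nonneg (s1 - s2), sq_nonneg (s1 - b * q), sq_nonneg (s2 - b * q)]
    have h8 : n * (P1 + P2) ≤ n * (X / κ) := mul_le_mul_of_nonneg_left hPX hn
    have h9 : q ^ 2 * b ^ 2 ≤ q ^ 2 * (2 / q * X) := mul_le_mul_of_nonneg_left hbX (by positivity)
    have e9 : q ^ 2 * (2 / q * X) = 2 * q * X := by field_simp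
    have h10 : a ^ 2 * T ^ 2 ≤ 4 * m ^ 2 + 4 * (n / κ + 2 * q) * X := by
      have e1 : n * (X / κ) = n / κ * X := by ring
      have e2 : (b * q) ^ 2 = q ^ 2 * b ^ 2 := by ring
      have e3 : 4 * (n / κ + 2 * q) * X = 4 * (n / κ * X) + 4 * (2 * q * X) := by ring
      rw [e9] at h9
      rw [mul_add, e1] at h8
      rw [mul_pow, e2] at h7
      rw [e3]
      linarith
    rw [hγ, hα]
    have : 4 / T ^ 2 * m ^ 2 + 4 * (n / κ + 2 * q) / T ^ 2 * X
      = (4 * m ^ 2 + 4 * (n / κ + 2 * q) * X) / T ^ 2 := by ring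
    rw [this, le_div_iff₀ (by positivity)]
    exact h10
  have hV : V ≤ A1 * X + D * γ * m ^ 2 := by
    have i1 : D * a ^ 2 ≤ D * (γ * m ^ 2 + α * X) := mul_le_mul_of_nonneg_left ha hD
    have i2 : R2 * b ^ 2 ≤ R2 * (2 / q * X) := mul_le_mul_of_nonneg_left hbX hR
    have e : A1 * X + D * γ * m ^ 2 = 3 * (X / κ) + D * (γ * m ^ 2 + α * X) + R2 * (2 / q * X) := by
      rw [hA1]; ring
    rw [e]; linarith
  have hW : W ≤ X + 2 * c * (A1 * X + D * γ * m ^ 2) := by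
    have : 0 ≤ 2 / q * m ^ 2 := by positivity
    have : 2 * c * V ≤ 2 * c * (A1 * X + D * γ * m ^ 2) := mul_le_mul_of_nonneg_left hV (by positivity)
    linarith
  have e : ((1 + 2 * c) * A1 + 1) * B
      + (((1 + 2 * c) * A1 + 1) * (2 / q) + (1 + 2 * c) * (D * γ)) * m ^ 2
      = ((1 + 2 * c) * A1 + 1) * X + (1 + 2 * c) * (D * γ) * m ^ 2 := by rw [hX]; ring
  rw [e]; linarith

theorem split0 {f : ℝ → ℝ} (hf : Integrable f) :
    ∫ x, f x = (∫ x in Ioi 0, f x) + ∫ x in Ioi 0, f (-x) := by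
  rw [integral_comp_neg_Ioi, neg_zero, ← setIntegral_univ, ← Iic_union_Ioi (a := (0:ℝ)),
    setIntegral_union (by rw [Set.disjoint_left]; intro x hx hx'; exact absurd (mem_Iic.1 hx) (not_le.2 hx'))
      measurableSet_Ioi hf.integrableOn hf.integrableOn, add_comm]

theorem int_Qqd {c : ℝ} (hc : 0 < c) : ∫ x in Ioi 0, Qsol c x * qd c x = - (Qsol c 0 ^ 2 / 2) := by
  refine ftc_Ioi (z := 0) (F := fun x => Qsol c x ^ 2 / 2) ((Qsol_cont.pow 2).div_const 2).continuousOn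
    (fun x _ _ => (((Qsol_hasDerivAt x).pow 2).div_const 2).congr_deriv (by simp; ring))
    (Imul (Q_dec hc).memLp (qd_dec hc).memLp).integrableOn ?_
  have := ((Q_dec hc).top.pow 2).div_const 2
  simpa using this

theorem int_Q2_pos {c : ℝ} (hc : 0 < c) : 0 < ∫ x in Ioi (0:ℝ), Qsol c x ^ 2 := by
  rw [setIntegral_pos_iff_support_of_nonneg_ae (ae_of_all _ fun x => sq_nonneg _)
    (Isq (Q_dec hc).memLp).integrableOn]
  have : Function.support (fun x => Qsol c x ^ 2) = univ := by
    ext x; simp [(Qsol_pos hc x).ne']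
  rw [this]; simp

theorem xQ2_dec {c : ℝ} (hc : 0 < c) : ExpDec (fun x => x * Qsol c x ^ 2 / 4) := by
  refine ExpDec.of_Q hc ((continuous_id.mul (Qsol_cont.pow 2)).div_const 4) 0 (3 * c / 2 / 4) le_rfl
    (by positivity) fun x => ?_
  have h1 := Qsol_pos hc x
  have h2 := Qsol_le hc x
  rw [abs_div, abs_mul, abs_of_pos (by positivity : (0:ℝ) < Qsol c x ^ 2)]
  rw [abs_of_pos (by norm_num : (0:ℝ) < 4)]
  have : Qsol c x ^ 2 ≤ 3 * c / 2 * Qsol c x := by nlinarith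
  have := mul_le_mul_of_nonneg_left this (abs_nonneg x)
  linarith

theorem int_QR_pos {c : ℝ} (hc : 0 < c) : 0 < ∫ x in Ioi 0, Qsol c x * Rf c x := by
  have i1 := Imul (Q_dec hc).memLp (Rf_dec hc).memLp
  have i2 := Isq (Q_dec hc).memLp
  have k := ftc_Ioi (a := 0) (z := 0) (F := fun x => x * Qsol c x ^ 2 / 4)
    (F' := fun x => c * (Qsol c x * Rf c x) - 3 / 4 * Qsol c x ^ 2)
    (xQ2_dec hc).cont.continuousOn ?_ (Isub (i1.const_mul c) (i2.const_mul _)).integrableOn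
    (xQ2_dec hc).top
  · rw [integral_sub (i1.const_mul c).integrableOn (i2.const_mul _).integrableOn,
      integral_const_mul, integral_const_mul] at k
    simp only [zero_mul, zero_div, neg_zero] at k
    have := int_Q2_pos hc
    have h : 0 < c * ∫ x in Ioi 0, Qsol c x * Rf c x := by linarith
    exact pos_of_mul_pos_right h hc.le
  · intro x _ _
    refine (((hasDerivAt_id x).mul ((Qsol_hasDerivAt x).pow 2)).div_const 4).congr_deriv ?_
    simp [Rf]
    field_simp
    ring

theorem coercive {c : ℝ} (hc : 0 < c) {x1 : ℝ} (ha : 0 < x1)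
    (hout : ∀ x, x1 ≤ x → 2 * Qsol c x ≤ c / 2) :
    ∃ K1 K2 : ℝ, 0 < K1 ∧ 0 < K2 ∧ ∀ (z : ℝ) (v v' : ℝ → ℝ), HK z v v' → x1 < z →
      v x1 = v (-x1) →
      ∫ x, (v x ^ 2 + v' x ^ 2) ≤ K1 * (∫ x, (v' x ^ 2 + (c - 2 * Qsol c x) * v x ^ 2))
        + K2 * (∫ x, Qsol c x * v x) ^ 2 := by
  obtain ⟨κ, hκ, H⟩ := half_form2 hc ha hout
  have mQ := (Q_dec hc).memLp
  have mq := (qd_dec hc).memLp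
  have mR := (Rf_dec hc).memLp
  have q0 := int_QR_pos hc
  have hQ0 := Qsol_pos hc 0
  have hn : 0 ≤ ∫ x in Ioi (0:ℝ), Qsol c x ^ 2 := integral_nonneg fun x => sq_nonneg _
  have hD : 0 ≤ ∫ x in Ioi (0:ℝ), qd c x ^ 2 := integral_nonneg fun x => sq_nonneg _
  have hR : 0 ≤ ∫ x in Ioi (0:ℝ), Rf c x ^ 2 := integral_nonneg fun x => sq_nonneg _
  obtain ⟨K1, K2, hK1, hK2, HA⟩ := coer_alg (κ := κ) (q := 2 * ∫ x in Ioi 0, Qsol c x * Rf c x)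
    (T := Qsol c 0 ^ 2) (n := ∫ x in Ioi (0:ℝ), Qsol c x ^ 2)
    (D := 6 * ∫ x in Ioi (0:ℝ), qd c x ^ 2)
    (R2 := 6 * ∫ x in Ioi (0:ℝ), Rf c x ^ 2) (c := c) hκ (by linarith) (by positivity) hn
    (by linarith) (by linarith) hc
  refine ⟨K1, K2, hK1, hK2, fun z v v' h hz hv => ?_⟩
  have hr := h.refl
  set b := 2 / 3 * v 0 with hb
  have hqx := qd_neg hc ha
  obtain ⟨a, haa⟩ : ∃ a, v x1 + a * qd c x1 - b * Rf c x1 = 0 := by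
    refine ⟨-(v x1 - b * Rf c x1) / qd c x1, ?_⟩
    rw [div_mul_cancel₀ _ hqx.ne]; ring
  have hb0 : v 0 - b * Rf c 0 = 0 := by rw [Rf_zero hc, hb]; ring
  have k1 := H z v v' h (fun x hx => by intro e; linarith [hx.2]) a b hb0 haa
  have k2 := H (-z) _ _ hr (fun x hx => by intro e; linarith [hx.1]) a b (by simpa using hb0)
    (by rw [← hv]; exact haa)
  rw [integral_add (Isq h.l2) (Isq h.l2')]
  have mv := h.l2
  have mw := hr.l2
  simp only [neg_sq] at k2
  -- the two remainders
  set r1 : ℝ → ℝ := fun x => v x + a * qd c x - b * Rf c x with hr1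
  set r2 : ℝ → ℝ := fun x => v (-x) + a * qd c x - b * Rf c x with hr2
  have mr1 : MemLp r1 2 := (mv.add (mq.const_mul a)).sub (mR.const_mul b)
  have mr2 : MemLp r2 2 := (mw.add (mq.const_mul a)).sub (mR.const_mul b)
  have m1 : ∀ {f : ℝ → ℝ}, MemLp f 2 → MemLp f 2 (volume.restrict (Ioi 0)) := fun hf => hf.restrict _
  refine HA (∫ x in Ioi 0, r1 x ^ 2) (∫ x in Ioi 0, r2 x ^ 2) a b _ _
    (∫ x in Ioi 0, Qsol c x * r1 x) (∫ x in Ioi 0, Qsol c x * r2 x) _ _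
    (integral_nonneg fun x => sq_nonneg _) (integral_nonneg fun x => sq_nonneg _) ?_ ?_
    (cs_ineq (m1 mQ) (m1 mr1)) (cs_ineq (m1 mQ) (m1 mr2)) ?_ ?_
  · rw [split0 (h.form_int hc), split0 (Imul mQ mv)]
    simp only [Qsol_even]
    linarith
  · rw [split0 (Imul mQ mv)]
    simp only [Qsol_even]
    have g : ∀ w : ℝ → ℝ, MemLp w 2 → ∫ x in Ioi 0, Qsol c x * (w x + a * qd c x - b * Rf c x)
      = (∫ x in Ioi 0, Qsol c x * w x) - a * (Qsol c 0 ^ 2 / 2)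
        - b * ∫ x in Ioi 0, Qsol c x * Rf c x := by
      intro w hw
      have e : ∀ x, Qsol c x * (w x + a * qd c x - b * Rf c x)
        = Qsol c x * w x + a * (Qsol c x * qd c x) - b * (Qsol c x * Rf c x) := fun x => by ring
      simp only [e]
      rw [integral_sub (Iadd (Imul (m1 mQ) (m1 hw)) ((Imul (m1 mQ) (m1 mq)).const_mul _))
        ((Imul (m1 mQ) (m1 mR)).const_mul _), integral_add (Imul (m1 mQ) (m1 hw))
        ((Imul (m1 mQ) (m1 mq)).const_mul _), integral_const_mul, integral_const_mul, int_Qqd hc]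
      ring
    rw [g v mv, g _ mw]; ring
  · rw [split0 (Isq mv)]
    have g : ∀ w : ℝ → ℝ, MemLp w 2 → ∫ x in Ioi 0, w x ^ 2
      ≤ 3 * (∫ x in Ioi 0, (w x + a * qd c x - b * Rf c x) ^ 2)
        + (3 * a ^ 2) * (∫ x in Ioi 0, qd c x ^ 2) + (3 * b ^ 2) * ∫ x in Ioi 0, Rf c x ^ 2 := by
      intro w hw
      have mr : MemLp (fun x => w x + a * qd c x - b * Rf c x) 2 :=
        (hw.add (mq.const_mul a)).sub (mR.const_mul b)
      have i1 := (Isq (m1 mr)).const_mul 3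
      have i2 := (Isq (m1 mq)).const_mul (3 * a ^ 2)
      have i3 := (Isq (m1 mR)).const_mul (3 * b ^ 2)
      rw [← integral_const_mul, ← integral_const_mul, ← integral_const_mul, ← integral_add i1 i2,
        ← integral_add (Iadd i1 i2) i3]
      apply integral_mono (Isq (m1 hw)) (Iadd (Iadd i1 i2) i3)
      intro x
      simp only
      set X := w x + a * qd c x - b * Rf c x with hX
      have e : w x = X - a * qd c x + b * Rf c x := by rw [hX]; ring
      rw [e]
      nlinarith [sq_nonneg (X + a * qd c x), sq_nonneg (X - b * Rf c x),
        sq_nonneg (a * qd c x + b * Rf c x)]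
    have g1 := g v mv
    have g2 := g _ mw
    linarith
  · have i1 := h.form_int hc
    have i2 := (Isq mv).const_mul (2 * c)
    rw [← integral_const_mul, ← integral_add i1 i2]
    apply integral_mono (Isq h.l2') (Iadd i1 i2)
    intro x
    have := Qsol_le hc x
    nlinarith [sq_nonneg (v x)]


/-- squared distance of a profile to the soliton centred at `y` -/
noncomputable def NN (c : ℝ) (w w' : ℝ → ℝ) (y : ℝ) : ℝ :=
  ∫ x, ((w x - Qsol c (x - y)) ^ 2 + (w' x - qd c (x - y)) ^ 2)

/-- mass -/
noncomputable def MM (w : ℝ → ℝ) : ℝ := ∫ x, w x ^ 2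

/-- energy -/
noncomputable def EE (w w' : ℝ → ℝ) : ℝ := ∫ x, (w' x ^ 2 / 2 - w x ^ 3 / 3)

theorem NN_nonneg (c : ℝ) (w w' : ℝ → ℝ) (y : ℝ) : 0 ≤ NN c w w' y :=
  integral_nonneg fun x => by positivity

theorem HK_zero (z : ℝ) : HK z (fun _ => 0) (fun _ => 0) where
  cont := continuous_const
  der x _ := hasDerivAt_const x 0
  l2 := MemLp.zero
  l2' := MemLp.zero
  top := tendsto_const_nhds
  bot := tendsto_const_nhds

theorem HK_Q {c : ℝ} (hc : 0 < c) (z : ℝ) : HK z (Qsol c) (qd c) := by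
  have := (HK_zero z).addE (Q_dec hc) (qd_dec hc) Qsol_hasDerivAt 1
  simpa using this

theorem HK.sub {z : ℝ} {v v' f f' : ℝ → ℝ} (h : HK z v v') (k : HK z f f') :
    HK z (fun x => v x - f x) (fun x => v' x - f' x) where
  cont := h.cont.sub k.cont
  der x hx := (h.der x hx).sub (k.der x hx)
  l2 := h.l2.sub k.l2
  l2' := h.l2'.sub k.l2'
  top := by simpa using h.top.sub k.top
  bot := by simpa using h.bot.sub k.bot

theorem HK.add {z : ℝ} {v v' f f' : ℝ → ℝ} (h : HK z v v') (k : HK z f f') :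
    HK z (fun x => v x + f x) (fun x => v' x + f' x) where
  cont := h.cont.add k.cont
  der x hx := (h.der x hx).add (k.der x hx)
  l2 := h.l2.add k.l2
  l2' := h.l2'.add k.l2'
  top := by simpa using h.top.add k.top
  bot := by simpa using h.bot.add k.bot

/-- translated soliton -/
theorem HK_Qy {c : ℝ} (hc : 0 < c) (z y : ℝ) :
    HK z (fun x => Qsol c (x - y)) (fun x => qd c (x - y)) := by
  have := (HK_Q hc (z - y)).shift (-y)
  simpa [sub_eq_add_neg] using this

theorem HK.energy {z : ℝ} {v v' : ℝ → ℝ} (h : HK z v v') :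
    Integrable (fun x => v x ^ 2 + v' x ^ 2) := Iadd (Isq h.l2) (Isq h.l2')

theorem NN_shift (c : ℝ) (w w' : ℝ → ℝ) (y : ℝ) :
    NN c w w' y = ∫ x, ((w (x + y) - Qsol c x) ^ 2 + (w' (x + y) - qd c x) ^ 2) := by
  unfold NN
  rw [← integral_add_right_eq_self _ y]
  simp

theorem HK.cube {z : ℝ} {v v' : ℝ → ℝ} (h : HK z v v') : Integrable (fun x => v x ^ 3) := by
  have e : (fun x => v x ^ 3) = fun x => v x * v x ^ 2 := by funext x; ring
  rw [e]
  apply (Isq h.l2).bdd_mul (c := Real.sqrt (∫ y, (v y ^ 2 + v' y ^ 2)))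
    h.cont.aestronglyMeasurable
  refine ae_of_all _ fun x => ?_
  exact Real.abs_le_sqrt (h.sup x)

theorem HK.cube_bd {z : ℝ} {v v' : ℝ → ℝ} (h : HK z v v') :
    |∫ x, v x ^ 3| ≤ Real.sqrt (∫ y, (v y ^ 2 + v' y ^ 2)) * ∫ x, v x ^ 2 := by
  rw [← integral_const_mul]
  refine (abs_integral_le_integral_abs).trans ?_
  apply integral_mono h.cube.abs ((Isq h.l2).const_mul _)
  intro x
  simp only
  have e : |v x ^ 3| = |v x| * v x ^ 2 := by
    rw [abs_pow, ← sq_abs (v x)]; ring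
  rw [e]
  exact mul_le_mul_of_nonneg_right (Real.abs_le_sqrt (h.sup x)) (sq_nonneg _)

theorem MM_shift (w : ℝ → ℝ) (y : ℝ) : MM w = ∫ x, w (x + y) ^ 2 := by
  unfold MM
  rw [← integral_add_right_eq_self _ y]

theorem EE_shift (w w' : ℝ → ℝ) (y : ℝ) :
    EE w w' = ∫ x, (w' (x + y) ^ 2 / 2 - w (x + y) ^ 3 / 3) := by
  unfold EE
  rw [← integral_add_right_eq_self _ y]

theorem HK.bddmul {f g : ℝ → ℝ} (hf : ExpDec f) (hg : Integrable g) :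
    Integrable (fun x => f x * g x) := by
  obtain ⟨K, k, hK, hk, hb⟩ := hf.bd
  apply hg.bdd_mul (c := K) hf.cont.aestronglyMeasurable
  refine ae_of_all _ fun x => (hb x).trans ?_
  have : Real.exp (-(k * |x|)) ≤ 1 := Real.exp_le_one_iff.2 (by nlinarith [abs_nonneg x])
  nlinarith

theorem expand_M {c z : ℝ} (hc : 0 < c) {v v' : ℝ → ℝ} (h : HK z v v') :
    MM (fun x => v x + Qsol c x) = MM (Qsol c) + 2 * (∫ x, Qsol c x * v x) + ∫ x, v x ^ 2 := by
  unfold MM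
  have e : ∀ x, (v x + Qsol c x) ^ 2 = Qsol c x ^ 2 + 2 * (Qsol c x * v x) + v x ^ 2 :=
    fun x => by ring
  have i1 := Isq (Q_dec hc).memLp
  have i2 := (Imul (Q_dec hc).memLp h.l2).const_mul 2
  simp only [e]
  rw [integral_add (Iadd i1 i2) (Isq h.l2), integral_add i1 i2, integral_const_mul]

theorem expand_S {c z : ℝ} (hc : 0 < c) {v v' : ℝ → ℝ} (h : HK z v v') :
    EE (fun x => v x + Qsol c x) (fun x => v' x + qd c x) + c / 2 * MM (fun x => v x + Qsol c x)
      = EE (Qsol c) (qd c) + c / 2 * MM (Qsol c)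
      + 1 / 2 * (∫ x, (v' x ^ 2 + (c - 2 * Qsol c x) * v x ^ 2)) - 1 / 3 * ∫ x, v x ^ 3 := by
  have mQ := (Q_dec hc).memLp
  have mq := (qd_dec hc).memLp
  have lin : ∫ x, (qd c x * v' x + (c * Qsol c x - Qsol c x ^ 2) * v x) = 0 := by
    refine ftc_line (z := z) (F := fun x => qd c x * v x) ((qd_cont hc).mul h.cont) ?_
      (Iadd (Imul mq h.l2') (Imul (qdd_dec hc).memLp h.l2)) ?_ ?_
    · intro x hx
      exact ((qd_hasDerivAt hc x).mul (h.der x hx)).congr_deriv (by ring)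
    · simpa using (qd_dec hc).top.mul h.top
    · simpa using (qd_dec hc).bot.mul h.bot
  have hs := (h.add (HK_Q hc z))
  have a1 : Integrable (fun x => (v' x + qd c x) ^ 2 / 2 - (v x + Qsol c x) ^ 3 / 3) :=
    Isub ((Isq hs.l2').div_const 2) (hs.cube.div_const 3)
  have a2 : Integrable (fun x => c / 2 * (v x + Qsol c x) ^ 2) := (Isq hs.l2).const_mul _
  have a3 : Integrable (fun x => qd c x ^ 2 / 2 - Qsol c x ^ 3 / 3) :=
    Isub ((Isq mq).div_const 2) ((HK_Q hc z).cube.div_const 3)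
  have a4 : Integrable (fun x => c / 2 * Qsol c x ^ 2) := (Isq mQ).const_mul _
  have a5 := (h.form_int hc).const_mul (1 / 2)
  have a6 := h.cube.const_mul (1 / 3)
  have a7 : Integrable (fun x => qd c x * v' x + (c * Qsol c x - Qsol c x ^ 2) * v x) :=
    (Iadd (Imul mq h.l2') (Imul (qdd_dec hc).memLp h.l2))
  have goal2 : (∫ x, (v' x + qd c x) ^ 2 / 2 - (v x + Qsol c x) ^ 3 / 3)
      + ∫ x, c / 2 * (v x + Qsol c x) ^ 2 =
      (∫ x, (qd c x ^ 2 / 2 - Qsol c x ^ 3 / 3)) + (∫ x, c / 2 * Qsol c x ^ 2)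
      + (∫ x, 1 / 2 * (v' x ^ 2 + (c - 2 * Qsol c x) * v x ^ 2)) - (∫ x, 1 / 3 * v x ^ 3)
      + ∫ x, (qd c x * v' x + (c * Qsol c x - Qsol c x ^ 2) * v x) := by
    rw [← integral_add a1 a2, ← integral_add a3 a4, ← integral_add (Iadd a3 a4) a5,
      ← integral_sub (Iadd (Iadd a3 a4) a5) a6, ← integral_add (Isub (Iadd (Iadd a3 a4) a5) a6) a7]
    congr 1
    funext x
    ring
  rw [lin, add_zero] at goal2
  simp only [integral_const_mul] at goal2
  unfold EE MM
  exact goal2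

/-- pointwise increments -/
theorem incr_bd {f f' : ℝ → ℝ} (hd : ∀ x, HasDerivAt f (f' x) x) {A k : ℝ} (hA : 0 ≤ A) (hk : 0 < k)
    (hb : ∀ x, |f' x| ≤ A * Real.exp (-(k * |x|))) {z : ℝ} (hz : |z| ≤ 1) (x : ℝ) :
    |f (x - z) - f x| ≤ A * Real.exp k * Real.exp (-(k * |x|)) * |z| := by
  have := (convex_Icc (x - |z|) (x + |z|)).norm_image_sub_le_of_norm_hasDerivWithin_le
    (f := f) (f' := f') (C := A * Real.exp k * Real.exp (-(k * |x|))) (x := x) (y := x - z)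
    (fun y _ => (hd y).hasDerivWithinAt) (fun y hy => ?_) ?_ ?_
  · simpa using this
  · refine (hb y).trans ?_
    rw [mul_assoc, ← Real.exp_add]
    apply mul_le_mul_of_nonneg_left _ hA
    apply Real.exp_le_exp.2
    have h1 : |x| ≤ |y| + 1 := by
      have : |x - y| ≤ 1 := by rw [abs_le]; constructor <;> linarith [hy.1, hy.2]
      have := abs_sub_abs_le_abs_sub x y
      linarith
    nlinarith
  · constructor <;> linarith [abs_nonneg z]
  · constructor <;> linarith [neg_abs_le z, le_abs_self z]

theorem dist_bd {c : ℝ} (hc : 0 < c) : ∃ K : ℝ, 0 < K ∧ ∀ z : ℝ, |z| ≤ 1 →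
    ∫ x, ((Qsol c (x - z) - Qsol c x) ^ 2 + (qd c (x - z) - qd c x) ^ 2) ≤ K * z ^ 2 := by
  obtain ⟨A1, k1, hA1, hk1, b1⟩ := (qd_dec hc).bd
  obtain ⟨A2, k2, hA2, hk2, b2⟩ := (qdd_dec hc).bd
  have i1 : Integrable (fun x : ℝ => (A1 * Real.exp k1) ^ 2 * Real.exp (-((2 * k1) * |x|))) :=
    (exp_abs_integrable (by positivity)).const_mul _
  have i2 : Integrable (fun x : ℝ => (A2 * Real.exp k2) ^ 2 * Real.exp (-((2 * k2) * |x|))) :=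
    (exp_abs_integrable (by positivity)).const_mul _
  have h0 : 0 ≤ ∫ x : ℝ, ((A1 * Real.exp k1) ^ 2 * Real.exp (-((2 * k1) * |x|))
    + (A2 * Real.exp k2) ^ 2 * Real.exp (-((2 * k2) * |x|))) := integral_nonneg fun x => by positivity
  refine ⟨(∫ x : ℝ, ((A1 * Real.exp k1) ^ 2 * Real.exp (-((2 * k1) * |x|))
    + (A2 * Real.exp k2) ^ 2 * Real.exp (-((2 * k2) * |x|)))) + 1, by linarith, fun z hz => ?_⟩
  have hI : Integrable fun x => (Qsol c (x - z) - Qsol c x) ^ 2 + (qd c (x - z) - qd c x) ^ 2 :=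
    ((HK_Qy hc 0 z).sub (HK_Q hc 0)).energy
  have : ∫ x, ((Qsol c (x - z) - Qsol c x) ^ 2 + (qd c (x - z) - qd c x) ^ 2)
      ≤ (∫ x : ℝ, ((A1 * Real.exp k1) ^ 2 * Real.exp (-((2 * k1) * |x|))
    + (A2 * Real.exp k2) ^ 2 * Real.exp (-((2 * k2) * |x|)))) * z ^ 2 := by
    rw [← integral_mul_const]
    apply integral_mono hI ((Iadd i1 i2).mul_const _)
    intro x
    simp only
    have p1 := incr_bd (fun x => Qsol_hasDerivAt (c := c) x) hA1 hk1 b1 hz x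
    have p2 := incr_bd (qd_hasDerivAt hc) hA2 hk2 b2 hz x
    have e : ∀ k : ℝ, Real.exp (-(2 * k * |x|)) = Real.exp (-(k * |x|)) ^ 2 := fun k => by
      rw [← Real.exp_nat_mul]; congr 1; push_cast; ring
    rw [e, e, add_mul]
    have q1 := pow_le_pow_left₀ (abs_nonneg _) p1 2
    have q2 := pow_le_pow_left₀ (abs_nonneg _) p2 2
    rw [sq_abs, mul_pow, mul_pow, sq_abs] at q1 q2
    linarith
  nlinarith [sq_nonneg z]

theorem NN_move {c : ℝ} (hc : 0 < c) : ∃ K : ℝ, 0 < K ∧ ∀ (z : ℝ) (w w' : ℝ → ℝ), HK z w w' →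
    ∀ y y0 : ℝ, |y - y0| ≤ 1 → NN c w w' y ≤ 2 * NN c w w' y0 + K * (y - y0) ^ 2 := by
  obtain ⟨K, hK, H⟩ := dist_bd hc
  refine ⟨2 * K, by positivity, fun z w w' h y y0 hy => ?_⟩
  have h1 := H (y - y0) hy
  rw [← integral_add_right_eq_self _ (-y0)] at h1
  have i1 := (h.sub (HK_Qy hc z y)).energy
  have i2 := (h.sub (HK_Qy hc z y0)).energy
  have i3 := ((HK_Qy hc z y).sub (HK_Qy hc z y0)).energy
  have e1 : ∀ x, x + -y0 - (y - y0) = x - y := fun x => by ring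
  have e2 : ∀ x, x + -y0 = x - y0 := fun x => by ring
  simp only [e1] at h1
  simp only [e2] at h1
  have : NN c w w' y ≤ 2 * NN c w w' y0 + 2 * ∫ x, ((Qsol c (x - y) - Qsol c (x - y0)) ^ 2
      + (qd c (x - y) - qd c (x - y0)) ^ 2) := by
    unfold NN
    rw [← integral_const_mul, ← integral_const_mul, ← integral_add (i2.const_mul 2) (i3.const_mul 2)]
    apply integral_mono i1 (Iadd (i2.const_mul 2) (i3.const_mul 2))
    intro x
    simp only
    nlinarith [sq_nonneg ((w x - Qsol c (x - y0)) + (Qsol c (x - y) - Qsol c (x - y0))),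
      sq_nonneg ((w' x - qd c (x - y0)) + (qd c (x - y) - qd c (x - y0)))]
  linarith

theorem NN_sup {c z : ℝ} (hc : 0 < c) {w w' : ℝ → ℝ} (h : HK z w w') (y x : ℝ) :
    (w x - Qsol c (x - y)) ^ 2 ≤ NN c w w' y :=
  (h.sub (HK_Qy hc z y)).sup x

theorem NN_pos {c z : ℝ} (hc : 0 < c) {w w' : ℝ → ℝ} (h : HK z w w') (h0 : ∀ x, 0 ≤ x → w x = 0)
    {y X : ℝ} (hN : NN c w w' y < Qsol c X ^ 2) : X < -y := by
  by_contra hX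
  push Not at hX
  have := NN_sup hc h y (X + y)
  rw [h0 (X + y) (by linarith), zero_sub, neg_sq, add_sub_cancel_right] at this
  linarith


theorem exists_x1 {c : ℝ} (hc : 0 < c) : ∃ x1 : ℝ, 0 < x1 ∧ ∀ x, x1 ≤ x → 2 * Qsol c x ≤ c / 2 := by
  have h := (Q_dec hc).top.eventually (ge_mem_nhds (show (0:ℝ) < c / 4 by positivity))
  obtain ⟨x1, h1⟩ := (h.and (eventually_gt_atTop 0)).exists_forall_of_atTop
  refine ⟨max x1 1, by positivity, fun x hx => ?_⟩
  have := (h1 x ((le_max_left _ _).trans hx)).1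
  linarith

theorem stat_core {c : ℝ} (hc : 0 < c) {x1 : ℝ} (hx1 : 0 < x1)
    (hout : ∀ x, x1 ≤ x → 2 * Qsol c x ≤ c / 2) :
    ∃ A1 A2 δ1 : ℝ, 0 < A1 ∧ 0 < A2 ∧ 0 < δ1 ∧ ∀ (w w' : ℝ → ℝ) (y : ℝ), HK 0 w w' → x1 < -y →
      w (x1 + y) = w (-x1 + y) → NN c w w' y ≤ δ1 →
      NN c w w' y ≤ A1 * (EE w w' + c / 2 * MM w - (EE (Qsol c) (qd c) + c / 2 * MM (Qsol c)))
        + A2 * (MM w - MM (Qsol c)) ^ 2 := by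
  obtain ⟨K1, K2, hK1, hK2, H⟩ := coercive hc hx1 hout
  refine ⟨4 * K1, K2, min 1 ((1 / (2 * (K1 + K2))) ^ 2), by positivity, hK2, by positivity, ?_⟩
  intro w w' y h hy hw hN
  have hs := (h.shift y).sub (HK_Q hc (0 - y))
  have co := H _ _ _ hs (by linarith) (by simp only [hw, Qsol_even])
  have eM := expand_M hc hs
  have eS := expand_S hc hs
  simp only [sub_add_cancel] at eM eS
  have t1 : MM (fun x => w (x + y)) = MM w := (MM_shift w y).symm
  have t2 : EE (fun x => w (x + y)) (fun x => w' (x + y)) = EE w w' := (EE_shift w w' y).symm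
  rw [t1] at eM eS
  rw [t2] at eS
  have cb := hs.cube_bd
  rw [← NN_shift] at co cb
  have hV : ∫ x, (w (x + y) - Qsol c x) ^ 2 ≤ NN c w w' y := by
    rw [NN_shift]
    apply integral_mono (Isq hs.l2) hs.energy
    intro x
    simp only
    nlinarith [sq_nonneg (w' (x + y) - qd c x)]
  have hV0 : 0 ≤ ∫ x, (w (x + y) - Qsol c x) ^ 2 := integral_nonneg fun x => sq_nonneg _
  set V := ∫ x, (w (x + y) - Qsol c x) ^ 2
  set N := NN c w w' y with hNdef
  have hN0 : 0 ≤ N := NN_nonneg _ _ _ _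
  set B := ∫ x, ((w' (x + y) - qd c x) ^ 2 + (c - 2 * Qsol c x) * (w (x + y) - Qsol c x) ^ 2)
  set m := ∫ x, Qsol c x * (w (x + y) - Qsol c x)
  set T := ∫ x, (w (x + y) - Qsol c x) ^ 3
  set dS := EE w w' + c / 2 * MM w - (EE (Qsol c) (qd c) + c / 2 * MM (Qsol c)) with hdS
  set dM := MM w - MM (Qsol c) with hdM
  have hB : B = 2 * dS + 2 / 3 * T := by linarith
  have hm : m = (dM - V) / 2 := by linarith
  set s := Real.sqrt N with hsdef
  have hs0 : 0 ≤ s := Real.sqrt_nonneg _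
  have hsN : s ^ 2 = N := Real.sq_sqrt hN0
  have hs1 : s ≤ 1 := by
    exact Real.sqrt_le_iff.2 ⟨by norm_num, by simpa using hN.trans (min_le_left _ _)⟩
  have hs2 : s * (2 * (K1 + K2)) ≤ 1 := by
    rw [← le_div_iff₀ (by positivity)]
    exact Real.sqrt_le_iff.2 ⟨by positivity, hN.trans (min_le_right _ _)⟩
  have hT : T ≤ s * N := ((le_abs_self _).trans cb).trans (mul_le_mul_of_nonneg_left hV hs0)
  have hm2 : m ^ 2 ≤ (dM ^ 2 + s * N) / 2 := by
    have h1 : V ^ 2 ≤ s * N := by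
      have : V ^ 2 ≤ N ^ 2 := pow_le_pow_left₀ hV0 hV 2
      have : N ^ 2 ≤ s * N := by
        have : N ≤ s := by rw [← hsN]; nlinarith
        nlinarith
      linarith
    rw [hm]
    nlinarith [sq_nonneg (dM + V)]
  have f1 : K1 * B ≤ K1 * (2 * dS) + K1 * (s * N) := by
    rw [hB, ← mul_add]
    apply mul_le_mul_of_nonneg_left _ hK1.le
    have : 0 ≤ s * N := by positivity
    linarith
  have f2 : K2 * m ^ 2 ≤ K2 * ((dM ^ 2 + s * N) / 2) := mul_le_mul_of_nonneg_left hm2 hK2.le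
  have f3 : s * (2 * (K1 + K2)) * N ≤ 1 * N := mul_le_mul_of_nonneg_right hs2 hN0
  have f4 : 0 ≤ K2 * (s * N) := by positivity
  have f5 : 0 ≤ K2 * dM ^ 2 := by positivity
  have f6 : s * (2 * (K1 + K2)) * N = 2 * (K1 * (s * N)) + 2 * (K2 * (s * N)) := by ring
  have f7 : K2 * ((dM ^ 2 + s * N) / 2) = (K2 * dM ^ 2) / 2 + (K2 * (s * N)) / 2 := by ring
  have f8 : 4 * K1 * dS = 2 * (K1 * (2 * dS)) := by ring
  rw [f6] at f3
  rw [f7] at f2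
  rw [f8]
  linarith

theorem stat {c : ℝ} (hc : 0 < c) : ∃ A1 A2 : ℝ, 0 < A1 ∧ 0 < A2 ∧ ∀ η : ℝ, 0 < η →
    ∃ δ0 : ℝ, 0 < δ0 ∧ ∀ (w w' : ℝ → ℝ) (y0 : ℝ), HK 0 w w' → (∀ x, 0 ≤ x → w x = 0) →
      NN c w w' y0 ≤ δ0 → ∃ y, |y - y0| ≤ η ∧
      NN c w w' y ≤ A1 * (EE w w' + c / 2 * MM w - (EE (Qsol c) (qd c) + c / 2 * MM (Qsol c)))
        + A2 * (MM w - MM (Qsol c)) ^ 2 := by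
  obtain ⟨x1, hx1, hout⟩ := exists_x1 hc
  obtain ⟨A1, A2, δ1, hA1, hA2, hδ1, H⟩ := stat_core hc hx1 hout
  obtain ⟨K, hK, HM⟩ := NN_move hc
  refine ⟨A1, A2, hA1, hA2, fun η hη => ?_⟩
  have hQx := Qsol_pos hc x1
  set δ2 := min δ1 (Qsol c x1 ^ 2 / 2) with hδ2
  have hδ20 : 0 < δ2 := by positivity
  -- reduced radius
  set η' := min (min η 1) (min x1 (Real.sqrt (δ2 / (2 * K)))) with hη'
  have hs : 0 < Real.sqrt (δ2 / (2 * K)) := Real.sqrt_pos.2 (by positivity)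
  have hη0 : 0 < η' := by positivity
  have l1 : η' ≤ η := (min_le_left _ _).trans (min_le_left _ _)
  have l2 : η' ≤ 1 := (min_le_left _ _).trans (min_le_right _ _)
  have l3 : η' ≤ x1 := (min_le_right _ _).trans (min_le_left _ _)
  have l4 : K * η' ^ 2 ≤ δ2 / 2 := by
    have : η' ≤ Real.sqrt (δ2 / (2 * K)) := (min_le_right _ _).trans (min_le_right _ _)
    have := pow_le_pow_left₀ hη0.le this 2
    rw [Real.sq_sqrt (by positivity), le_div_iff₀ (by positivity)] at this
    linarith
  set g := Qsol c (x1 - η') - Qsol c (x1 + η') with hg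
  have hg0 : 0 < g := by
    have := Qsol_strictAnti hc (mem_Ici.2 (by linarith : 0 ≤ x1 - η'))
      (mem_Ici.2 (by linarith : 0 ≤ x1 + η')) (by linarith)
    linarith
  refine ⟨min (δ2 / 4) ((g / 2) ^ 2), by positivity, fun w w' y0 h h0 hN => ?_⟩
  have hN1 : NN c w w' y0 ≤ δ2 / 4 := hN.trans (min_le_left _ _)
  have hN2 : NN c w w' y0 ≤ (g / 2) ^ 2 := hN.trans (min_le_right _ _)
  have near : ∀ x, |w x - Qsol c (x - y0)| ≤ g / 2 := fun x =>
    abs_le_of_sq_le_sq ((NN_sup hc h y0 x).trans hN2) (by positivity)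
  have hGc : ContinuousOn (fun y => w (x1 + y) - w (-x1 + y)) (Icc (y0 - η') (y0 + η')) :=
    ((h.cont.comp (continuous_const.add continuous_id)).sub
      (h.cont.comp (continuous_const.add continuous_id))).continuousOn
  have ivt := intermediate_value_Icc' (by linarith : y0 - η' ≤ y0 + η') hGc
  have b1 := abs_le.1 (near (x1 + (y0 + η')))
  have b2 := abs_le.1 (near (-x1 + (y0 + η')))
  have b3 := abs_le.1 (near (x1 + (y0 - η')))
  have b4 := abs_le.1 (near (-x1 + (y0 - η')))
  have e1 : Qsol c (x1 + (y0 + η') - y0) = Qsol c (x1 + η') := by congr 1; ring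
  have e2 : Qsol c (-x1 + (y0 + η') - y0) = Qsol c (x1 - η') := by
    rw [← Qsol_even]; congr 1; ring
  have e3 : Qsol c (x1 + (y0 - η') - y0) = Qsol c (x1 - η') := by congr 1; ring
  have e4 : Qsol c (-x1 + (y0 - η') - y0) = Qsol c (x1 + η') := by
    rw [← Qsol_even]; congr 1; ring
  rw [e1] at b1
  rw [e2] at b2
  rw [e3] at b3
  rw [e4] at b4
  obtain ⟨y, hy, hGy⟩ := ivt (show (0:ℝ) ∈ Icc _ _ from
    ⟨by linarith [b1.2, b2.1], by linarith [b3.1, b4.2]⟩)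
  have hyy : |y - y0| ≤ η' := by rw [abs_le]; constructor <;> linarith [hy.1, hy.2]
  have hNy : NN c w w' y ≤ δ2 := by
    have := HM 0 w w' h y y0 (hyy.trans l2)
    have h2 : (y - y0) ^ 2 ≤ η' ^ 2 := by
      rw [← sq_abs]; exact pow_le_pow_left₀ (abs_nonneg _) hyy 2
    have := mul_le_mul_of_nonneg_left h2 hK.le
    linarith
  refine ⟨y, hyy.trans l1, H w w' y h ?_ ?_ (hNy.trans (min_le_left _ _))⟩
  · apply NN_pos hc h h0
    have := hNy.trans (min_le_right _ _)
    have : 0 < Qsol c x1 ^ 2 := by positivity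
    linarith
  · simp only at hGy; linarith


theorem near_bd {c : ℝ} (hc : 0 < c) : ∃ K : ℝ, 0 < K ∧ ∀ (w w' : ℝ → ℝ) (y e : ℝ), HK 0 w w' →
    0 ≤ e → e ≤ 1 → NN c w w' y ≤ e ^ 2 → |MM w - MM (Qsol c)| ≤ K * e ∧
      |EE w w' + c / 2 * MM w - (EE (Qsol c) (qd c) + c / 2 * MM (Qsol c))| ≤ K * e ^ 2 := by
  have hq0 : 0 ≤ MM (Qsol c) := integral_nonneg fun x => sq_nonneg _
  refine ⟨(2 * Real.sqrt (MM (Qsol c)) + 1) + (1 + 4 * c + 1), by positivity, ?_⟩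
  intro w w' y e h he he1 hN
  have hs := (h.shift y).sub (HK_Q hc (0 - y))
  have eM := expand_M hc hs
  have eS := expand_S hc hs
  simp only [sub_add_cancel] at eM eS
  have t1 : MM (fun x => w (x + y)) = MM w := (MM_shift w y).symm
  have t2 : EE (fun x => w (x + y)) (fun x => w' (x + y)) = EE w w' := (EE_shift w w' y).symm
  rw [t1] at eM eS
  rw [t2] at eS
  have cb := hs.cube_bd
  rw [← NN_shift] at cb
  have hB : |∫ x, ((w' (x + y) - qd c x) ^ 2 + (c - 2 * Qsol c x) * (w (x + y) - Qsol c x) ^ 2)|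
      ≤ (1 + 4 * c) * NN c w w' y := by
    rw [NN_shift, ← integral_const_mul]
    refine abs_integral_le_integral_abs.trans ?_
    apply integral_mono (hs.form_int hc).abs (hs.energy.const_mul _)
    intro x
    simp only
    have q1 := Qsol_pos hc x
    have q2 := Qsol_le hc x
    rw [abs_le]
    constructor <;> nlinarith [sq_nonneg (w' (x + y) - qd c x), sq_nonneg (w (x + y) - Qsol c x)]
  have hV : ∫ x, (w (x + y) - Qsol c x) ^ 2 ≤ NN c w w' y := by
    rw [NN_shift]
    apply integral_mono (Isq hs.l2) hs.energy
    intro x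
    simp only
    nlinarith [sq_nonneg (w' (x + y) - qd c x)]
  have hV0 : 0 ≤ ∫ x, (w (x + y) - Qsol c x) ^ 2 := integral_nonneg fun x => sq_nonneg _
  have hm := cs_ineq (Q_dec hc).memLp hs.l2
  change _ ≤ MM (Qsol c) * _ at hm
  set V := ∫ x, (w (x + y) - Qsol c x) ^ 2
  set N := NN c w w' y with hNdef
  have hN0 : 0 ≤ N := NN_nonneg _ _ _ _
  set B := ∫ x, ((w' (x + y) - qd c x) ^ 2 + (c - 2 * Qsol c x) * (w (x + y) - Qsol c x) ^ 2)
  set m := ∫ x, Qsol c x * (w (x + y) - Qsol c x)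
  set T := ∫ x, (w (x + y) - Qsol c x) ^ 3
  have hsq : Real.sqrt N ≤ e := Real.sqrt_le_iff.2 ⟨he, hN⟩
  have hT : |T| ≤ e ^ 2 := by
    refine cb.trans ?_
    have := Real.sqrt_nonneg N
    nlinarith
  have hmm : |m| ≤ Real.sqrt (MM (Qsol c)) * e := by
    apply abs_le_of_sq_le_sq _ (by positivity)
    rw [mul_pow, Real.sq_sqrt hq0]
    refine hm.trans (mul_le_mul_of_nonneg_left (hV.trans hN) hq0)
  have he2 : e ^ 2 ≤ e := by nlinarith
  have hse : 0 ≤ Real.sqrt (MM (Qsol c)) * e := by positivity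
  have hse2 : 0 ≤ Real.sqrt (MM (Qsol c)) * e ^ 2 := by positivity
  have hce : 0 ≤ c * e := by positivity
  have hce2 : 0 ≤ c * e ^ 2 := by positivity
  have hcN : c * N ≤ c * e ^ 2 := mul_le_mul_of_nonneg_left hN hc.le
  rw [abs_le] at hmm hT hB
  constructor
  · rw [eM, abs_le]
    constructor <;> nlinarith
  · rw [eS, abs_le]
    constructor <;> nlinarith [sq_nonneg e]

theorem stab {c : ℝ} (hc : 0 < c) : ∃ K : ℝ, 0 < K ∧ ∀ η : ℝ, 0 < η → ∃ δ : ℝ, 0 < δ ∧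
    ∀ (e : ℝ) (w0 w0' : ℝ → ℝ) (y00 : ℝ), 0 ≤ e → e ≤ 1 → HK 0 w0 w0' → NN c w0 w0' y00 ≤ e ^ 2 →
    ∀ (w w' : ℝ → ℝ) (y0 : ℝ), HK 0 w w' → (∀ x, 0 ≤ x → w x = 0) → MM w ≤ MM w0 →
      EE w w' ≤ EE w0 w0' → NN c w w' y0 ≤ δ → ∃ y, |y - y0| ≤ η ∧ NN c w w' y ≤ (K * e) ^ 2 := by
  obtain ⟨A1, A2, hA1, hA2, HS⟩ := stat hc
  obtain ⟨K0, hK0, HN⟩ := near_bd hc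
  set K' := K0 + c / 2 * K0 with hK'
  have hK'0 : 0 < K' := by positivity
  set D := K0 + 4 * K' / c with hD
  have hD0 : 0 < D := by positivity
  refine ⟨Real.sqrt (A1 * K0 + A2 * D ^ 2), by positivity, fun η hη => ?_⟩
  obtain ⟨δ0, hδ0, H⟩ := HS η hη
  set e1 := min 1 (A1 * c / (4 * A2 * K0)) with he1
  have he10 : 0 < e1 := by positivity
  refine ⟨min δ0 (e1 ^ 2), by positivity, ?_⟩
  intro e w0 w0' y00 he he1' h0 hN0 w w' y0 h hz hM hE hN
  obtain ⟨y, hy, hNy⟩ := H w w' y0 h hz (hN.trans (min_le_left _ _))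
  refine ⟨y, hy, ?_⟩
  obtain ⟨a1, a2⟩ := HN w0 w0' y00 e h0 he he1' hN0
  obtain ⟨b1, -⟩ := HN w w' y0 e1 h he10.le (min_le_left _ _) (hN.trans (min_le_right _ _))
  rw [abs_le] at a1 a2 b1
  have hn := NN_nonneg c w w' y
  have he2 : e ^ 2 ≤ e := by nlinarith
  set dM := MM w - MM (Qsol c) with hdM
  set dE := EE w w' - EE (Qsol c) (qd c) with hdE
  have hdS : EE w w' + c / 2 * MM w - (EE (Qsol c) (qd c) + c / 2 * MM (Qsol c))
    = dE + c / 2 * dM := by rw [hdM, hdE]; ring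
  rw [hdS] at hNy
  have s1 : dE + c / 2 * dM ≤ K0 * e ^ 2 := by
    have : c / 2 * MM w ≤ c / 2 * MM w0 := mul_le_mul_of_nonneg_left hM (by positivity)
    rw [← hdS]; linarith [a2.2]
  have s2 : dM ≤ K0 * e := by linarith [a1.2]
  have s3 : dE ≤ K' * e := by
    have i1 : EE w0 w0' - EE (Qsol c) (qd c) ≤ K0 * e ^ 2 - c / 2 * (MM w0 - MM (Qsol c)) := by
      linarith [a2.2]
    have i2 : c / 2 * (-(K0 * e)) ≤ c / 2 * (MM w0 - MM (Qsol c)) :=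
      mul_le_mul_of_nonneg_left a1.1 (by positivity)
    have i3 : K0 * e ^ 2 ≤ K0 * e := mul_le_mul_of_nonneg_left he2 hK0.le
    rw [hdE, hK']; linarith
  have s4 : |dM| ≤ D * e := by
    rw [abs_le]
    have p1 : 0 ≤ 4 * K' / c * e := by positivity
    have p2 : 0 ≤ K0 * e := by positivity
    refine ⟨?_, by rw [hD, add_mul]; linarith⟩
    rcases le_or_gt 0 dM with hd | hd
    · have : 0 ≤ D * e := by positivity
      linarith
    · -- small negative mass defect
      have i1 : -dM ≤ A1 * c / (4 * A2) := by
        have : K0 * e1 ≤ K0 * (A1 * c / (4 * A2 * K0)) :=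
          mul_le_mul_of_nonneg_left (min_le_right _ _) hK0.le
        have e : K0 * (A1 * c / (4 * A2 * K0)) = A1 * c / (4 * A2) := by field_simp
        linarith [b1.1]
      have i2 : A2 * dM ^ 2 ≤ A1 * c / 4 * (-dM) := by
        have : (-dM) * (-dM) ≤ A1 * c / (4 * A2) * (-dM) :=
          mul_le_mul_of_nonneg_right i1 (by linarith)
        have := mul_le_mul_of_nonneg_left this hA2.le
        have e : A2 * (A1 * c / (4 * A2) * (-dM)) = A1 * c / 4 * (-dM) := by field_simp
        nlinarith
      have i3 : A1 * (c / 4 * (-dM)) ≤ A1 * (K' * e) := by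
        have := mul_le_mul_of_nonneg_left s3 hA1.le
        linarith
      have i4 := le_of_mul_le_mul_left i3 hA1
      have i5 : -dM ≤ 4 * K' / c * e := by
        rw [div_mul_eq_mul_div, le_div_iff₀ hc]; linarith
      rw [hD, add_mul]; linarith
  rw [mul_pow, Real.sq_sqrt (by positivity)]
  have s5 : dM ^ 2 ≤ D ^ 2 * e ^ 2 := by
    rw [← sq_abs, ← mul_pow]; exact pow_le_pow_left₀ (abs_nonneg _) s4 2
  have := mul_le_mul_of_nonneg_left s5 hA2.le
  have := mul_le_mul_of_nonneg_left s1 hA1.le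
  linarith


/-- smooth functions of two variables -/
def Sm (f : ℝ → ℝ → ℝ) : Prop := ContDiff ℝ (⊤ : ℕ∞) (Function.uncurry f)

/-- derivative in the first variable -/
noncomputable def px (f : ℝ → ℝ → ℝ) : ℝ → ℝ → ℝ := fun x t => deriv (fun y => f y t) x

/-- derivative in the second variable -/
noncomputable def pt (f : ℝ → ℝ → ℝ) : ℝ → ℝ → ℝ := fun x t => deriv (fun s => f x s) t

theorem Sm.fd {f : ℝ → ℝ → ℝ} (h : Sm f) (p : ℝ × ℝ) :
    HasFDerivAt (Function.uncurry f) (fderiv ℝ (Function.uncurry f) p) p :=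
  (h.differentiable (by simp) p).hasFDerivAt

theorem Sm.hx' {f : ℝ → ℝ → ℝ} (h : Sm f) (x t : ℝ) :
    HasDerivAt (fun y => f y t) (fderiv ℝ (Function.uncurry f) (x, t) (1, 0)) x := by
  have h1 : HasDerivAt (fun y : ℝ => (y, t)) ((1:ℝ), (0:ℝ)) x :=
    (hasDerivAt_id x).prodMk (hasDerivAt_const x t)
  exact (h.fd (x, t)).comp_hasDerivAt x h1

theorem Sm.ht' {f : ℝ → ℝ → ℝ} (h : Sm f) (x t : ℝ) :
    HasDerivAt (fun s => f x s) (fderiv ℝ (Function.uncurry f) (x, t) (0, 1)) t := by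
  have h1 : HasDerivAt (fun s : ℝ => (x, s)) ((0:ℝ), (1:ℝ)) t :=
    (hasDerivAt_const t x).prodMk (hasDerivAt_id t)
  exact (h.fd (x, t)).comp_hasDerivAt t h1

theorem Sm.hx {f : ℝ → ℝ → ℝ} (h : Sm f) (x t : ℝ) : HasDerivAt (fun y => f y t) (px f x t) x := by
  have := h.hx' x t
  unfold px; rwa [this.deriv]

theorem Sm.ht {f : ℝ → ℝ → ℝ} (h : Sm f) (x t : ℝ) : HasDerivAt (fun s => f x s) (pt f x t) t := by
  have := h.ht' x t
  unfold pt; rwa [this.deriv]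

theorem Sm.px_eq {f : ℝ → ℝ → ℝ} (h : Sm f) :
    Function.uncurry (px f) = fun p => fderiv ℝ (Function.uncurry f) p (1, 0) := by
  funext ⟨x, t⟩
  exact (h.hx' x t).deriv

theorem Sm.pt_eq {f : ℝ → ℝ → ℝ} (h : Sm f) :
    Function.uncurry (pt f) = fun p => fderiv ℝ (Function.uncurry f) p (0, 1) := by
  funext ⟨x, t⟩
  exact (h.ht' x t).deriv

theorem Sm.dir {f : ℝ → ℝ → ℝ} (h : Sm f) (v : ℝ × ℝ) :
    ContDiff ℝ (⊤ : ℕ∞) (fun p => fderiv ℝ (Function.uncurry f) p v) := by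
  have : ContDiff ℝ (⊤ : ℕ∞) (fderiv ℝ (Function.uncurry f)) :=
    ContDiff.fderiv_right h (by simp)
  exact this.clm_apply contDiff_const

theorem Sm.px {f : ℝ → ℝ → ℝ} (h : Sm f) : Sm (px f) := by
  unfold Sm; rw [h.px_eq]; exact h.dir _

theorem Sm.pt {f : ℝ → ℝ → ℝ} (h : Sm f) : Sm (pt f) := by
  unfold Sm; rw [h.pt_eq]; exact h.dir _

theorem Sm.comm {f : ℝ → ℝ → ℝ} (h : Sm f) : _root_.pt (_root_.px f) = _root_.px (_root_.pt f) := by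
  funext x t
  have e1 := h.px.pt_eq
  have e2 := h.pt.px_eq
  have a1 : _root_.pt (_root_.px f) x t = Function.uncurry (_root_.pt (_root_.px f)) (x, t) := rfl
  have a2 : _root_.px (_root_.pt f) x t = Function.uncurry (_root_.px (_root_.pt f)) (x, t) := rfl
  rw [a1, a2, e1, e2, h.px_eq, h.pt_eq]
  have hd : DifferentiableAt ℝ (fderiv ℝ (Function.uncurry f)) (x, t) := by
    have : ContDiff ℝ (⊤ : ℕ∞) (fderiv ℝ (Function.uncurry f)) :=
      ContDiff.fderiv_right h (by simp)
    exact this.differentiable (by simp) _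
  have hs : IsSymmSndFDerivAt ℝ (Function.uncurry f) (x, t) :=
    (ContDiff.contDiffAt h).isSymmSndFDerivAt (by
      simp only [minSmoothness_of_isRCLikeNormedField]
      exact WithTop.coe_le_coe.2 (le_top (a := (2 : ℕ∞))))
  simp only
  rw [fderiv_clm_apply hd (by fun_prop), fderiv_clm_apply hd (by fun_prop)]
  simp
  exact hs _ _

theorem Sm.add {f g : ℝ → ℝ → ℝ} (hf : Sm f) (hg : Sm g) : Sm (fun x t => f x t + g x t) :=
  ContDiff.add hf hg

theorem Sm.mul {f g : ℝ → ℝ → ℝ} (hf : Sm f) (hg : Sm g) : Sm (fun x t => f x t * g x t) :=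
  ContDiff.mul hf hg

theorem Sm.cmul {f : ℝ → ℝ → ℝ} (hf : Sm f) (a : ℝ) : Sm (fun x t => a * f x t) :=
  ContDiff.mul contDiff_const hf

theorem Sm.contx {f : ℝ → ℝ → ℝ} (hf : Sm f) (t : ℝ) : Continuous (fun x => f x t) :=
  hf.continuous.comp (by fun_prop : Continuous fun x : ℝ => (x, t))

theorem Sm.contt {f : ℝ → ℝ → ℝ} (hf : Sm f) (x : ℝ) : Continuous (fun t => f x t) :=
  hf.continuous.comp (by fun_prop : Continuous fun t : ℝ => (x, t))

/-- differentiation under the integral sign -/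
theorem param {H : ℝ → ℝ → ℝ} (hH : Sm H) (a b t : ℝ) :
    HasDerivAt (fun s => ∫ x in a..b, H x s) (∫ x in a..b, pt H x t) t := by
  have hc : Continuous (Function.uncurry (pt H)) := hH.pt.continuous
  have hK : IsCompact ((uIcc a b) ×ˢ (Icc (t - 1) (t + 1))) := isCompact_uIcc.prod isCompact_Icc
  obtain ⟨C, hC⟩ := hK.exists_bound_of_continuousOn hc.continuousOn
  have := intervalIntegral.hasDerivAt_integral_of_dominated_loc_of_deriv_le (μ := volume)
    (F := fun s x => H x s) (F' := fun s x => pt H x s) (a := a) (b := b) (x₀ := t)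
    (s := Icc (t - 1) (t + 1)) (bound := fun _ => C)
    (Icc_mem_nhds (by linarith) (by linarith))
    (Eventually.of_forall fun s => (hH.contx s).aestronglyMeasurable)
    ((hH.contx t).intervalIntegrable _ _)
    (hH.pt.contx t).aestronglyMeasurable
    (ae_of_all _ fun x hx s hs => hC (x, s) ⟨uIoc_subset_uIcc hx, hs⟩)
    intervalIntegrable_const
    (ae_of_all _ fun x _ s _ => hH.ht x s)
  exact this.2

theorem iter0 (u : ℝ → ℝ → ℝ) (t x : ℝ) : iteratedDeriv 0 (fun z => u z t) x = u x t := by simp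
theorem iter1 (u : ℝ → ℝ → ℝ) (t x : ℝ) : iteratedDeriv 1 (fun z => u z t) x = px u x t := by
  simp [px]
theorem iter2 (u : ℝ → ℝ → ℝ) (t x : ℝ) : iteratedDeriv 2 (fun z => u z t) x = px (px u) x t := by
  rw [iteratedDeriv_succ]
  have : iteratedDeriv 1 (fun z => u z t) = fun y => px u y t := by funext y; exact iter1 u t y
  rw [this]; rfl
theorem iter3 (u : ℝ → ℝ → ℝ) (t x : ℝ) :
    iteratedDeriv 3 (fun z => u z t) x = px (px (px u)) x t := by
  rw [iteratedDeriv_succ]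
  have : iteratedDeriv 2 (fun z => u z t) = fun y => px (px u) y t := by funext y; exact iter2 u t y
  rw [this]; rfl


/-- extension by zero of the solution -/
noncomputable def wt (u : ℝ → ℝ → ℝ) (t : ℝ) : ℝ → ℝ := (Iio 0).indicator (fun x => u x t)
noncomputable def wd (u : ℝ → ℝ → ℝ) (t : ℝ) : ℝ → ℝ := (Iio 0).indicator (fun x => px u x t)
noncomputable def Wf (u : ℝ → ℝ → ℝ) : ℝ → ℝ → ℝ := fun x t => px (px u) x t + u x t * u x t

theorem wt_zero (u : ℝ → ℝ → ℝ) (t x : ℝ) (hx : 0 ≤ x) : wt u t x = 0 :=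
  indicator_of_notMem (by simpa using hx) _

theorem wt_neg (u : ℝ → ℝ → ℝ) (t x : ℝ) (hx : x < 0) : wt u t x = u x t :=
  indicator_of_mem (show x ∈ Iio 0 from hx) _

theorem wd_neg (u : ℝ → ℝ → ℝ) (t x : ℝ) (hx : x < 0) : wd u t x = px u x t :=
  indicator_of_mem (show x ∈ Iio 0 from hx) _

theorem wd_zero (u : ℝ → ℝ → ℝ) (t x : ℝ) (hx : 0 ≤ x) : wd u t x = 0 :=
  indicator_of_notMem (by simpa using hx) _

section
variable {u : ℝ → ℝ → ℝ} (hu : LeftKdVSolution u (Iic 0))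

theorem LeftKdVSolution.sm (hu : LeftKdVSolution u (Iic 0)) : Sm u := hu.smooth

theorem LeftKdVSolution.smW (hu : LeftKdVSolution u (Iic 0)) : Sm (Wf u) :=
  hu.sm.px.px.add (hu.sm.mul hu.sm)

theorem LeftKdVSolution.eq' (hu : LeftKdVSolution u (Iic 0)) {x t : ℝ} (hx : x ≤ 0) (ht : t ≤ 0) :
    pt u x t = - px (Wf u) x t := by
  have h := hu.eqn x hx t ht
  have e : (fun y => iteratedDeriv 2 (fun z => u z t) y + (u y t) ^ 2) = fun y => Wf u y t := by
    funext y
    rw [iter2]; unfold Wf; ring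
  rw [e] at h
  have : pt u x t + px (Wf u) x t = 0 := h
  linarith

theorem LeftKdVSolution.unif (hu : LeftKdVSolution u (Iic 0)) (a : ℝ) : ∃ g : ℝ → ℝ,
    IntegrableOn g (Iio 0) ∧ ∀ t ∈ Icc a 0, ∀ x < (0:ℝ), ∀ n ≤ 3,
      |iteratedDeriv n (fun z => u z t) x| + (iteratedDeriv n (fun z => u z t) x) ^ 2 ≤ g x := by
  refine (isCompact_Icc (a := a) (b := (0:ℝ))).induction_on
    (p := fun s => ∃ g : ℝ → ℝ,
    IntegrableOn g (Iio 0) ∧ ∀ t ∈ s, ∀ x < (0:ℝ), ∀ n ≤ 3,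
      |iteratedDeriv n (fun z => u z t) x| + (iteratedDeriv n (fun z => u z t) x) ^ 2 ≤ g x)
    ?_ ?_ ?_ ?_
  · exact ⟨fun _ => 0, integrableOn_zero, fun t ht => absurd ht (notMem_empty t)⟩
  · rintro s t hst ⟨g, hg, h⟩
    exact ⟨g, hg, fun r hr => h r (hst hr)⟩
  · rintro s t ⟨g, hg, h⟩ ⟨g', hg', h'⟩
    refine ⟨fun x => |g x| + |g' x|, hg.abs.add hg'.abs, ?_⟩
    rintro r (hr | hr) x hx n hn
    · have := h r hr x hx n hn
      linarith [le_abs_self (g x), abs_nonneg (g' x)]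
    · have := h' r hr x hx n hn
      linarith [le_abs_self (g' x), abs_nonneg (g x)]
  · intro t ht
    obtain ⟨ε, hε, g, hg, h⟩ := hu.locUnif t ht.2
    refine ⟨Icc a 0 ∩ Metric.ball t ε, inter_mem self_mem_nhdsWithin
      (mem_nhdsWithin_of_mem_nhds (Metric.ball_mem_nhds t hε)), g, hg, ?_⟩
    intro s hs x hx n hn
    exact h s hs.1.2 (by simpa [Real.dist_eq] using hs.2) x hx n hn

/-- the uniform bound in terms of partial derivatives -/
theorem LeftKdVSolution.unif' (hu : LeftKdVSolution u (Iic 0)) (a : ℝ) : ∃ g : ℝ → ℝ,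
    IntegrableOn g (Iio 0) ∧ ∀ t ∈ Icc a 0, ∀ x < (0:ℝ),
      (|u x t| ≤ g x ∧ u x t ^ 2 ≤ g x) ∧ (|px u x t| ≤ g x ∧ px u x t ^ 2 ≤ g x) ∧
      |px (px u) x t| ≤ g x ∧ |px (px (px u)) x t| ≤ g x := by
  obtain ⟨g, hg, h⟩ := hu.unif a
  refine ⟨g, hg, fun t ht x hx => ?_⟩
  have a0 := h t ht x hx 0 (by norm_num)
  have a1 := h t ht x hx 1 (by norm_num)
  have a2 := h t ht x hx 2 (by norm_num)
  have a3 := h t ht x hx 3 (by norm_num)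
  rw [iter0] at a0
  rw [iter1] at a1
  rw [iter2] at a2
  rw [iter3] at a3
  refine ⟨⟨?_, ?_⟩, ⟨?_, ?_⟩, ?_, ?_⟩
  · linarith [sq_nonneg (u x t)]
  · linarith [abs_nonneg (u x t)]
  · linarith [sq_nonneg (px u x t)]
  · linarith [abs_nonneg (px u x t)]
  · linarith [sq_nonneg (px (px u) x t)]
  · linarith [sq_nonneg (px (px (px u)) x t)]

theorem LeftKdVSolution.hk (hu : LeftKdVSolution u (Iic 0)) (h0 : ∀ t ≤ (0:ℝ), u 0 t = 0) {t : ℝ}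
    (ht : t ≤ 0) : HK 0 (wt u t) (wd u t) where
  cont := by
    have e : wt u t = fun x => u (min x 0) t := by
      funext x
      rcases lt_or_ge x 0 with h | h
      · rw [wt_neg u t x h, min_eq_left h.le]
      · rw [wt_zero u t x h, min_eq_right h, h0 t ht]
    rw [e]
    exact (hu.sm.contx t).comp (continuous_id.min continuous_const)
  der x hx := by
    rcases lt_or_gt_of_ne hx with h | h
    · rw [wd_neg u t x h]
      refine (hu.sm.hx x t).congr_of_eventuallyEq ?_
      filter_upwards [Iio_mem_nhds h] with y hy
      exact wt_neg u t y hy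
    · rw [wd_zero u t x h.le]
      refine (hasDerivAt_const x (0:ℝ)).congr_of_eventuallyEq ?_
      filter_upwards [Ioi_mem_nhds h] with y hy
      exact wt_zero u t y (le_of_lt hy)
  l2 := by
    unfold wt
    rw [memLp_indicator_iff_restrict measurableSet_Iio,
      memLp_two_iff_integrable_sq (hu.sm.contx t).aestronglyMeasurable]
    have := hu.int2 t ht 0 (by norm_num)
    simp only [iter0] at this
    exact this
  l2' := by
    unfold wd
    rw [memLp_indicator_iff_restrict measurableSet_Iio,
      memLp_two_iff_integrable_sq (hu.sm.px.contx t).aestronglyMeasurable]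
    have := hu.int2 t ht 1 (by norm_num)
    simp only [iter1] at this
    exact this
  top := by
    refine tendsto_const_nhds.congr' ?_
    filter_upwards [eventually_ge_atTop 0] with x hx
    rw [wt_zero u t x hx]
  bot := by
    have := hu.decay t ht 0 (by norm_num)
    simp only [iter0] at this
    refine this.congr' ?_
    filter_upwards [eventually_lt_atBot 0] with x hx
    rw [wt_neg u t x hx]

end

theorem freq_small {g : ℝ → ℝ} (hg : IntegrableOn g (Iio 0)) {ε : ℝ} (hε : 0 < ε) :
    ∃ᶠ R : ℝ in atTop, 0 < R ∧ g (-R) < ε := by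
  rw [frequently_atTop]
  intro R0
  by_contra hcon
  push Not at hcon
  set R1 := max R0 1 with hR1
  have h1 : ∀ x < -R1, ε ≤ g x := by
    intro x hx
    have a1 := le_max_left R0 1
    have a2 := le_max_right R0 1
    have := hcon (-x) (by linarith) (by linarith)
    simpa using this
  have h2 : IntegrableOn (fun _ : ℝ => ε) (Iio (-R1)) := by
    have hg' : IntegrableOn g (Iio (-R1)) := hg.mono_set (Iio_subset_Iio (by
      have a2 := le_max_right R0 1
      linarith))
    refine Integrable.mono' hg' aestronglyMeasurable_const ?_
    refine (ae_restrict_iff' measurableSet_Iio).2 (ae_of_all _ fun x hx => ?_)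
    rw [Real.norm_eq_abs, abs_of_pos hε]
    exact h1 x hx
  rw [integrableOn_const_iff] at h2
  simp [hε.ne'] at h2


theorem mono_gen {D F : ℝ → ℝ → ℝ} (hD : Sm D) (hF : Sm F) {g : ℝ → ℝ}
    (hg : IntegrableOn g (Iio 0)) {t K : ℝ} (ht : t ≤ 0) (hK : 0 ≤ K)
    (hDt : IntegrableOn (fun x => D x t) (Iic 0)) (hD0 : IntegrableOn (fun x => D x 0) (Iic 0))
    (hDF : ∀ x ≤ (0:ℝ), ∀ s ≤ (0:ℝ), pt D x s = px F x s) (hF0 : ∀ s < 0, 0 ≤ F 0 s)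
    (hFR : ∀ s ∈ Icc t 0, ∀ x < (0:ℝ), g x < 1 → F x s ≤ K * g x) :
    ∫ x in Iic 0, D x t ≤ ∫ x in Iic 0, D x 0 := by
  rcases ht.eq_or_lt with rfl | htl
  · exact le_rfl
  have lim : Tendsto (fun R : ℝ => (∫ x in (-R)..0, D x t) - ∫ x in (-R)..0, D x 0) atTop
      (nhds ((∫ x in Iic 0, D x t) - ∫ x in Iic 0, D x 0)) :=
    (intervalIntegral_tendsto_integral_Iic 0 hDt tendsto_neg_atTop_atBot).sub
    (intervalIntegral_tendsto_integral_Iic 0 hD0 tendsto_neg_atTop_atBot)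
  have key : ∀ ε : ℝ, 0 < ε → ε < 1 →
      (∫ x in Iic 0, D x t) - ∫ x in Iic 0, D x 0 ≤ (-t) * (K * ε) := by
    intro ε h0 h1
    refine le_of_tendsto_of_frequently lim ((freq_small hg h0).mono ?_)
    rintro R ⟨hR, hgR⟩
    obtain ⟨s, hs, he⟩ := exists_hasDerivAt_eq_slope (fun s => ∫ x in (-R)..0, D x s)
      (fun s => ∫ x in (-R)..0, pt D x s) htl
      (fun s _ => (param hD (-R) 0 s).continuousAt.continuousWithinAt)
      (fun s _ => param hD (-R) 0 s)
    have h2 : ∫ x in (-R)..0, pt D x s = F 0 s - F (-R) s := by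
      rw [← intervalIntegral.integral_eq_sub_of_hasDerivAt (f := fun x => F x s)
        (f' := fun x => px F x s) (fun x _ => hF.hx x s) ((hF.px.contx s).intervalIntegrable _ _)]
      refine intervalIntegral.integral_congr fun x hx => ?_
      rw [uIcc_of_le (by linarith)] at hx
      exact hDF x hx.2 s hs.2.le
    rw [h2] at he
    have h3 := hF0 s hs.2
    have h4 := hFR s ⟨hs.1.le, hs.2.le⟩ (-R) (by linarith) (by linarith)
    have h5 : K * g (-R) ≤ K * ε := mul_le_mul_of_nonneg_left hgR.le hK
    rw [eq_div_iff (by linarith)] at he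
    have h6 : -(K * ε) * (0 - t) ≤ (F 0 s - F (-R) s) * (0 - t) :=
      mul_le_mul_of_nonneg_right (by linarith) (by linarith)
    linarith
  have h7 : (∫ x in Iic 0, D x t) - ∫ x in Iic 0, D x 0 ≤ 0 := by
    have l2 : Tendsto (fun ε : ℝ => (-t) * (K * ε)) (nhdsWithin 0 (Ioi 0)) (nhds 0) := by
      have : Continuous (fun ε : ℝ => (-t) * (K * ε)) := by fun_prop
      have := this.tendsto 0
      simp only [mul_zero] at this
      exact this.mono_left nhdsWithin_le_nhds
    refine ge_of_tendsto l2 ?_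
    filter_upwards [Ioo_mem_nhdsGT (show (0:ℝ) < 1 by norm_num)] with ε hε
    exact key ε hε.1 hε.2
  linarith

section
variable {u : ℝ → ℝ → ℝ}

theorem Wf_hx (hu : LeftKdVSolution u (Iic 0)) (x t : ℝ) :
    px (Wf u) x t = px (px (px u)) x t + 2 * u x t * px u x t := by
  have h := (hu.sm.px.px.hx x t).add ((hu.sm.hx x t).mul (hu.sm.hx x t))
  have := h.deriv
  have e : px (Wf u) x t = deriv ((fun y => px (px u) y t) + (fun y => u y t) * fun y => u y t) x := rfl
  rw [e, this]; ring

theorem MM_eq (hu : LeftKdVSolution u (Iic 0)) (t : ℝ) :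
    MM (wt u t) = ∫ x in Iic 0, u x t * u x t := by
  unfold MM
  rw [integral_Iic_eq_integral_Iio, ← integral_indicator measurableSet_Iio]
  congr 1; funext x
  rcases lt_or_ge x 0 with h | h
  · rw [wt_neg u t x h, indicator_of_mem (show x ∈ Iio 0 from h)]; ring
  · rw [wt_zero u t x h, indicator_of_notMem (by simpa using h)]; ring

theorem EE_eq (hu : LeftKdVSolution u (Iic 0)) (t : ℝ) :
    EE (wt u t) (wd u t) = ∫ x in Iic 0, ((1/2) * (px u x t * px u x t)
      + (-1/3) * (u x t * (u x t * u x t))) := by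
  unfold EE
  rw [integral_Iic_eq_integral_Iio, ← integral_indicator measurableSet_Iio]
  congr 1; funext x
  rcases lt_or_ge x 0 with h | h
  · rw [wt_neg u t x h, wd_neg u t x h, indicator_of_mem (show x ∈ Iio 0 from h)]; ring
  · rw [wt_zero u t x h, wd_zero u t x h, indicator_of_notMem (by simpa using h)]; ring

theorem Iic_int {f w : ℝ → ℝ} (hw : Integrable w) (h : ∀ x < (0:ℝ), f x = w x) :
    IntegrableOn f (Iic 0) := by
  rw [integrableOn_Iic_iff_integrableOn_Iio]
  exact hw.integrableOn.congr_fun (fun x hx => (h x hx).symm) measurableSet_Iio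

theorem mass_mono (hu : LeftKdVSolution u (Iic 0)) (h0 : ∀ t ≤ (0:ℝ), u 0 t = 0) {t : ℝ}
    (ht : t ≤ 0) : MM (wt u t) ≤ MM (wt u 0) := by
  rw [MM_eq hu, MM_eq hu]
  obtain ⟨g, hg, hb⟩ := hu.unif' t
  have h_integ : ∀ s ≤ (0:ℝ), IntegrableOn (fun x => u x s * u x s) (Iic 0) := fun s hs =>
    Iic_int (Isq (hu.hk h0 hs).l2) fun x hx => by rw [wt_neg u s x hx]; ring
  have hF : Sm (fun x t => (-2) * (u x t * Wf u x t) + (px u x t * px u x t +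
      (2/3) * (u x t * (u x t * u x t)))) :=
    ((hu.sm.mul hu.smW).cmul _).add ((hu.sm.px.mul hu.sm.px).add
      ((hu.sm.mul (hu.sm.mul hu.sm)).cmul _))
  refine mono_gen (D := fun x t => u x t * u x t) (hu.sm.mul hu.sm) hF hg (K := 6) ht
    (by norm_num) (h_integ t ht) (h_integ 0 le_rfl) ?_ ?_ ?_
  · intro x hx s hs
    have a1 := ((hu.sm.ht x s).mul (hu.sm.ht x s)).deriv
    have a2 := ((((hu.sm.hx x s).mul (hu.smW.hx x s)).const_mul (-2)).add
      (((hu.sm.px.hx x s).mul (hu.sm.px.hx x s)).add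
        (((hu.sm.hx x s).mul ((hu.sm.hx x s).mul (hu.sm.hx x s))).const_mul (2/3)))).deriv
    refine a1.trans (Eq.trans ?_ a2.symm)
    rw [hu.eq' hx hs]
    simp only [Pi.mul_apply, Wf]
    ring
  · intro s hs
    simp only [h0 s hs.le]
    nlinarith [mul_self_nonneg (px u 0 s)]
  · intro s hs x hx hgx
    obtain ⟨⟨b1, b2⟩, ⟨b3, b4⟩, b5, b6⟩ := hb s hs x hx
    have g0 : 0 ≤ g x := (abs_nonneg _).trans b1
    have w : |Wf u x s| ≤ 2 * g x := by
      unfold Wf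
      refine (abs_add_le _ _).trans ?_
      rw [abs_mul_self]; linarith [sq (u x s)]
    have c1 : |u x s * Wf u x s| ≤ g x * (2 * g x) := by
      rw [abs_mul]; exact mul_le_mul b1 w (abs_nonneg _) g0
    have c2 : |u x s * (u x s * u x s)| ≤ g x * g x := by
      rw [abs_mul, abs_mul_self]; exact mul_le_mul b1 (by linarith [sq (u x s)]) (mul_self_nonneg _) g0
    have c3 : g x * g x ≤ g x := by nlinarith
    have := neg_abs_le (u x s * Wf u x s)
    have := le_abs_self (u x s * (u x s * u x s))
    nlinarith [sq (px u x s)]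

theorem energy_mono (hu : LeftKdVSolution u (Iic 0)) (h0 : ∀ t ≤ (0:ℝ), u 0 t = 0) {t : ℝ}
    (ht : t ≤ 0) : EE (wt u t) (wd u t) ≤ EE (wt u 0) (wd u 0) := by
  rw [EE_eq hu, EE_eq hu]
  obtain ⟨g, hg, hb⟩ := hu.unif' t
  have h_integ : ∀ s ≤ (0:ℝ), IntegrableOn (fun x => (1/2) * (px u x s * px u x s)
      + (-1/3) * (u x s * (u x s * u x s))) (Iic 0) := fun s hs =>
    Iic_int (Iadd ((Isq (hu.hk h0 hs).l2').const_mul (1/2)) ((hu.hk h0 hs).cube.const_mul (-1/3)))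
      fun x hx => by rw [wt_neg u s x hx, wd_neg u s x hx]; ring
  have hD : Sm (fun x s => (1/2) * (px u x s * px u x s)
      + (-1/3) * (u x s * (u x s * u x s))) :=
    ((hu.sm.px.mul hu.sm.px).cmul _).add ((hu.sm.mul (hu.sm.mul hu.sm)).cmul _)
  have hF : Sm (fun x t => px u x t * pt u x t + (1/2) * (Wf u x t * Wf u x t)) :=
    (hu.sm.px.mul hu.sm.pt).add ((hu.smW.mul hu.smW).cmul _)
  refine mono_gen hD hF hg (K := 5) ht
    (by norm_num) (h_integ t ht) (h_integ 0 le_rfl) ?_ ?_ ?_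
  · intro x hx s hs
    have a1 := ((((hu.sm.px.ht x s).mul (hu.sm.px.ht x s)).const_mul (1/2)).add
      (((hu.sm.ht x s).mul ((hu.sm.ht x s).mul (hu.sm.ht x s))).const_mul (-1/3))).deriv
    have a2 := (((hu.sm.px.hx x s).mul (hu.sm.pt.hx x s)).add
      (((hu.smW.hx x s).mul (hu.smW.hx x s)).const_mul (1/2))).deriv
    refine a1.trans (Eq.trans ?_ a2.symm)
    have e := hu.eq' hx hs
    have e' : px (Wf u) x s = - pt u x s := by linarith
    rw [hu.sm.comm, e']
    simp only [Pi.mul_apply, Wf]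
    ring
  · intro s hs
    have : pt u 0 s = 0 := by
      have : (fun r => u 0 r) =ᶠ[nhds s] fun _ => 0 := by
        filter_upwards [Iio_mem_nhds hs] with r hr
        exact h0 r (le_of_lt hr)
      unfold pt
      rw [this.deriv_eq]; simp
    rw [this]
    nlinarith [mul_self_nonneg (Wf u 0 s)]
  · intro s hs x hx hgx
    obtain ⟨⟨b1, b2⟩, ⟨b3, b4⟩, b5, b6⟩ := hb s hs x hx
    have g0 : 0 ≤ g x := (abs_nonneg _).trans b1
    have w : |Wf u x s| ≤ 2 * g x := by
      unfold Wf
      refine (abs_add_le _ _).trans ?_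
      rw [abs_mul_self]; linarith [sq (u x s)]
    have c3 : g x * g x ≤ g x := by nlinarith
    have c4 : |pt u x s| ≤ 3 * g x := by
      rw [hu.eq' hx.le hs.2, Wf_hx hu, abs_neg]
      refine (abs_add_le _ _).trans ?_
      have : |2 * u x s * px u x s| ≤ 2 * (g x * g x) := by
        rw [mul_assoc, abs_mul, abs_mul, abs_two]
        have := mul_le_mul b1 b3 (abs_nonneg _) g0
        linarith
      linarith
    have c1 : |px u x s * pt u x s| ≤ g x * (3 * g x) := by
      rw [abs_mul]; exact mul_le_mul b3 c4 (abs_nonneg _) g0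
    have c5 : |Wf u x s * Wf u x s| ≤ (2 * g x) * (2 * g x) := by
      rw [abs_mul]; exact mul_le_mul w w (abs_nonneg _) (by linarith)
    have := le_abs_self (px u x s * pt u x s)
    have := le_abs_self (Wf u x s * Wf u x s)
    linarith
end


/-- cut-off version of the identity function -/
structure Phi (φ : ℝ → ℝ) : Prop where
  smooth : ContDiff ℝ (⊤ : ℕ∞) φ
  supp : ∀ x, 1/2 ≤ |x| → φ x = 0
  sgn : ∀ x, 0 ≤ x * φ x
  pos : 0 < φ (1/4)

theorem exists_phi : ∃ φ, Phi φ := by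
  let χ : ContDiffBump (0:ℝ) := ⟨1/4, 1/2, by norm_num, by norm_num⟩
  refine ⟨fun x => x * χ x, contDiff_id.mul χ.contDiff, ?_, ?_, ?_⟩
  · intro x hx
    have : χ x = 0 := χ.zero_of_le_dist (by
      rw [Real.dist_eq, sub_zero]; exact hx)
    simp [this]
  · intro x
    have := χ.nonneg (x := x)
    nlinarith [mul_self_nonneg x, mul_nonneg (mul_self_nonneg x) this]
  · have : χ (1/4) = 1 := χ.one_of_mem_closedBall (by simp [χ])
    rw [this]; norm_num

theorem Qsol_smooth (c : ℝ) : ContDiff ℝ (⊤ : ℕ∞) (Qsol c) := by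
  unfold Qsol
  refine contDiff_const.mul (ContDiff.pow (contDiff_const.div ?_ ?_) 2)
  · exact Real.contDiff_cosh.comp (by fun_prop)
  · intro x; exact (Real.cosh_pos _).ne'

noncomputable def JJ (c : ℝ) (φ : ℝ → ℝ) (z : ℝ) : ℝ := ∫ x in (-1:ℝ)..1, Qsol c (x - z) * φ x

theorem Jlow {c : ℝ} (hc : 0 < c) {φ : ℝ → ℝ} (hφ : Phi φ) : ∃ κ > 0, ∃ z0 > 0, ∀ z, |z| ≤ z0 →
    κ * |z| ≤ |JJ c φ z - JJ c φ 0| := by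
  have hS : Sm (fun x z => Qsol c (x - z) * φ x) := by
    unfold Sm Function.uncurry
    exact ((Qsol_smooth c).comp (by fun_prop)).mul (hφ.smooth.comp (by fun_prop))
  have hd := param hS (-1) 1 0
  set A := ∫ x in (-1:ℝ)..1, pt (fun x z => Qsol c (x - z) * φ x) x 0 with hA
  have hA' : A = ∫ x in (-1:ℝ)..1, -(qd c x * φ x) := by
    rw [hA]
    refine intervalIntegral.integral_congr fun x _ => ?_
    have h1 : HasDerivAt (fun z : ℝ => x - z) (-1) 0 := by
      simpa using (hasDerivAt_id (0:ℝ)).const_sub x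
    have h2 : HasDerivAt (fun z : ℝ => Qsol c (x - z)) (qd c x * (-1)) 0 := by
      have := Qsol_hasDerivAt (c := c) (x - 0)
      have h3 := HasDerivAt.comp (0:ℝ) this h1
      simpa [Function.comp_def] using h3
    have := (h2.mul_const (φ x)).deriv
    refine Eq.trans this ?_
    ring
  have hpos : 0 < A := by
    rw [hA']
    have hn : ∀ x, 0 ≤ -(qd c x * φ x) := by
      intro x
      have hs := hφ.sgn x
      rcases lt_trichotomy x 0 with h | h | h
      · have q : 0 < qd c x := by
          have := qd_neg hc (s := -x) (by linarith)
          rw [qd_odd] at this; linarith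
        have : φ x ≤ 0 := by
          by_contra hh; push Not at hh
          linarith [mul_neg_of_neg_of_pos h hh]
        linarith [mul_nonneg q.le (by linarith : 0 ≤ - φ x)]
      · subst h; simp [qd_zero]
      · have q := qd_neg hc h
        have : 0 ≤ φ x := by
          by_contra hh; push Not at hh
          linarith [mul_neg_of_pos_of_neg h hh]
        linarith [mul_nonneg (by linarith : 0 ≤ - qd c x) this]
    refine intervalIntegral.integral_pos (by norm_num) ?_ (fun x _ => hn x) ?_
    · exact ((qd_cont hc).mul hφ.smooth.continuous).neg.continuousOn
    · refine ⟨1/4, by norm_num, ?_⟩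
      have q := qd_neg hc (s := 1/4) (by norm_num)
      linarith [mul_pos (by linarith : 0 < - qd c (1/4)) hφ.pos]
  have ho := (hasDerivAt_iff_isLittleO.1 hd).def (half_pos hpos)
  rw [Metric.eventually_nhds_iff] at ho
  obtain ⟨r, hr, H⟩ := ho
  refine ⟨A/2, by linarith, r/2, by linarith, fun z hz => ?_⟩
  have := H (y := z) (by rw [Real.dist_eq, sub_zero]; linarith)
  simp only [Real.norm_eq_abs, sub_zero, smul_eq_mul] at this
  have e : |JJ c φ z - JJ c φ 0 - z * A| ≤ A/2 * |z| := by
    unfold JJ; simpa only [sub_zero] using this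
  have e2 : |z * A| = A * |z| := by rw [abs_mul, abs_of_pos hpos]; ring
  have := abs_sub_abs_le_abs_sub (z * A) (JJ c φ z - JJ c φ 0)
  rw [abs_sub_comm (z * A)] at this
  linarith

/-- bounds for a smooth function with compact support -/
theorem Phi.bdd {φ : ℝ → ℝ} (hφ : Phi φ) : ∃ B > 0, ∀ x ∈ Icc (-1:ℝ) 1, |φ x| ≤ B ∧
    |deriv φ x| ≤ B ∧ |deriv (deriv (deriv φ)) x| ≤ B := by
  have c1 : ContDiff ℝ (⊤ : ℕ∞) (deriv φ) := hφ.smooth.deriv'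
  have c2 : ContDiff ℝ (⊤ : ℕ∞) (deriv (deriv φ)) := c1.deriv'
  have c3 : ContDiff ℝ (⊤ : ℕ∞) (deriv (deriv (deriv φ))) := c2.deriv'
  obtain ⟨B0, h0⟩ := isCompact_Icc.exists_bound_of_continuousOn (s := Icc (-1:ℝ) 1)
    hφ.smooth.continuous.continuousOn
  obtain ⟨B1, h1⟩ := isCompact_Icc.exists_bound_of_continuousOn (s := Icc (-1:ℝ) 1)
    c1.continuous.continuousOn
  obtain ⟨B3, h3⟩ := isCompact_Icc.exists_bound_of_continuousOn (s := Icc (-1:ℝ) 1)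
    c3.continuous.continuousOn
  refine ⟨|B0| + |B1| + |B3| + 1, by positivity, fun x hx => ?_⟩
  have a0 := h0 x hx
  have a1 := h1 x hx
  have a3 := h3 x hx
  rw [Real.norm_eq_abs] at a0 a1 a3
  have := le_abs_self B0
  have := le_abs_self B1
  have := le_abs_self B3
  have := abs_nonneg B0
  have := abs_nonneg B1
  have := abs_nonneg B3
  refine ⟨by linarith, by linarith, by linarith⟩


noncomputable def hh (u : ℝ → ℝ → ℝ) (φ y : ℝ → ℝ) (t : ℝ) : ℝ :=
  ∫ x in (-1:ℝ)..1, u (x + y t) t * φ x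

theorem Phi.c1 {φ : ℝ → ℝ} (hφ : Phi φ) : ContDiff ℝ (⊤ : ℕ∞) (deriv φ) := hφ.smooth.deriv'
theorem Phi.c2 {φ : ℝ → ℝ} (hφ : Phi φ) : ContDiff ℝ (⊤ : ℕ∞) (deriv (deriv φ)) := hφ.c1.deriv'
theorem Phi.c3 {φ : ℝ → ℝ} (hφ : Phi φ) : ContDiff ℝ (⊤ : ℕ∞) (deriv (deriv (deriv φ))) :=
  hφ.c2.deriv'
theorem Phi.d0 {φ : ℝ → ℝ} (hφ : Phi φ) (x : ℝ) : HasDerivAt φ (deriv φ x) x :=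
  (hφ.smooth.differentiable (by simp) x).hasDerivAt
theorem Phi.d1 {φ : ℝ → ℝ} (hφ : Phi φ) (x : ℝ) : HasDerivAt (deriv φ) (deriv (deriv φ) x) x :=
  (hφ.c1.differentiable (by simp) x).hasDerivAt
theorem Phi.d2 {φ : ℝ → ℝ} (hφ : Phi φ) (x : ℝ) :
    HasDerivAt (deriv (deriv φ)) (deriv (deriv (deriv φ)) x) x :=
  (hφ.c2.differentiable (by simp) x).hasDerivAt

theorem Phi.z0 {φ : ℝ → ℝ} (hφ : Phi φ) {x : ℝ} (hx : 1/2 < |x|) : φ =ᶠ[nhds x] fun _ => 0 := by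
  have : {y : ℝ | 1/2 < |y|} ∈ nhds x := (isOpen_lt continuous_const continuous_abs).mem_nhds hx
  filter_upwards [this] with y hy
  exact hφ.supp y (le_of_lt hy)

theorem Phi.z1 {φ : ℝ → ℝ} (hφ : Phi φ) {x : ℝ} (hx : 1/2 < |x|) :
    deriv φ =ᶠ[nhds x] fun _ => 0 := by
  have := (hφ.z0 hx).deriv
  simpa using this

theorem Phi.z2 {φ : ℝ → ℝ} (hφ : Phi φ) {x : ℝ} (hx : 1/2 < |x|) :
    deriv (deriv φ) =ᶠ[nhds x] fun _ => 0 := by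
  have := (hφ.z1 hx).deriv
  simpa using this

/-- integration by parts for the soliton -/
theorem ibp_Q {c : ℝ} (hc : 0 < c) {φ : ℝ → ℝ} (hφ : Phi φ) :
    ∫ x in (-1:ℝ)..1, ((Qsol c x ^ 2 - c * Qsol c x) * deriv φ x
      + Qsol c x * deriv (deriv (deriv φ)) x) = 0 := by
  have h : ∀ x, HasDerivAt (fun x => -(qd c x * deriv φ x - Qsol c x * deriv (deriv φ) x))
      ((Qsol c x ^ 2 - c * Qsol c x) * deriv φ x + Qsol c x * deriv (deriv (deriv φ)) x) x := by
    intro x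
    have := (((qd_hasDerivAt hc x).mul (hφ.d1 x)).sub
      ((Qsol_hasDerivAt (c := c) x).mul (hφ.d2 x))).neg
    refine this.congr_deriv ?_
    ring
  have e1 : ∀ x : ℝ, 1/2 < |x| → -(qd c x * deriv φ x - Qsol c x * deriv (deriv φ) x) = 0 := by
    intro x hx
    rw [(hφ.z1 hx).self_of_nhds, (hφ.z2 hx).self_of_nhds]; ring
  have q := Qsol_cont (c := c)
  have p1 := hφ.c1.continuous
  have p3 := hφ.c3.continuous
  rw [intervalIntegral.integral_eq_sub_of_hasDerivAt (fun x _ => h x)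
    (Continuous.intervalIntegrable (by fun_prop) _ _),
    e1 1 (by norm_num), e1 (-1) (by norm_num)]
  ring

theorem ibp_u {c : ℝ} {u : ℝ → ℝ → ℝ} (hu : Sm u) {φ : ℝ → ℝ} (hφ : Phi φ) (y t : ℝ) :
    ∫ x in (-1:ℝ)..1, (c * px u (x + y) t - px (Wf u) (x + y) t) * φ x =
    ∫ x in (-1:ℝ)..1, ((u (x + y) t ^ 2 - c * u (x + y) t) * deriv φ x
      + u (x + y) t * deriv (deriv (deriv φ)) x) := by
  have hW : Sm (Wf u) := hu.px.px.add (hu.mul hu)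
  have sh : ∀ (f : ℝ → ℝ → ℝ), Sm f → ∀ x, HasDerivAt (fun x => f (x + y) t) (px f (x + y) t) x :=
    fun f hf x => (hf.hx (x + y) t).comp_add_const x y
  have h : ∀ x, HasDerivAt (fun x => (c * u (x + y) t - Wf u (x + y) t) * φ x
      + px u (x + y) t * deriv φ x - u (x + y) t * deriv (deriv φ) x)
      ((c * px u (x + y) t - px (Wf u) (x + y) t) * φ x
        - ((u (x + y) t ^ 2 - c * u (x + y) t) * deriv φ x
      + u (x + y) t * deriv (deriv (deriv φ)) x)) x := by
    intro x
    have := ((((((sh u hu x).const_mul c).sub (sh _ hW x)).mul (hφ.d0 x)).add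
      ((sh _ hu.px x).mul (hφ.d1 x))).sub ((sh u hu x).mul (hφ.d2 x)))
    refine this.congr_deriv ?_
    simp only [Wf, Pi.sub_apply]
    ring
  have e1 : ∀ x : ℝ, 1/2 < |x| → (c * u (x + y) t - Wf u (x + y) t) * φ x
      + px u (x + y) t * deriv φ x - u (x + y) t * deriv (deriv φ) x = 0 := by
    intro x hx
    rw [(hφ.z0 hx).self_of_nhds, (hφ.z1 hx).self_of_nhds, (hφ.z2 hx).self_of_nhds]; ring
  have p0 := hφ.smooth.continuous
  have p1 := hφ.c1.continuous
  have p3 := hφ.c3.continuous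
  have shc : ∀ (f : ℝ → ℝ → ℝ), Sm f → Continuous fun x => f (x + y) t := fun f hf =>
    (hf.contx t).comp (by fun_prop : Continuous fun x : ℝ => x + y)
  have q0 := shc u hu
  have q1 := shc _ hu.px
  have qW := shc _ hW.px
  have i1 : Continuous fun x => (c * px u (x + y) t - px (Wf u) (x + y) t) * φ x :=
    ((continuous_const.mul q1).sub qW).mul p0
  have i2 : Continuous fun x => (u (x + y) t ^ 2 - c * u (x + y) t) * deriv φ x
      + u (x + y) t * deriv (deriv (deriv φ)) x :=
    (((q0.pow 2).sub (continuous_const.mul q0)).mul p1).add (q0.mul p3)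
  rw [← sub_eq_zero, ← intervalIntegral.integral_sub (i1.intervalIntegrable _ _)
    (i2.intervalIntegrable _ _), intervalIntegral.integral_eq_sub_of_hasDerivAt (fun x _ => h x)
    ((i1.sub i2).intervalIntegrable _ _),
    e1 1 (by norm_num), e1 (-1) (by norm_num)]
  ring

theorem hh_deriv {c : ℝ} (hc : 0 < c) {φ : ℝ → ℝ} (hφ : Phi φ) : ∃ K > 0, ∀ (u : ℝ → ℝ → ℝ),
    LeftKdVSolution u (Iic 0) → (∀ t ≤ (0:ℝ), u 0 t = 0) → ∀ y0 s t : ℝ, t ≤ 0 →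
      y0 + c * (t - s) < -1 → ∀ m : ℝ, 0 ≤ m → m ≤ 1 →
      NN c (wt u t) (wd u t) (y0 + c * (t - s)) ≤ m ^ 2 →
      ∃ d, HasDerivAt (hh u φ (fun t => y0 + c * (t - s))) d t ∧ |d| ≤ K * m := by
  obtain ⟨B, hB, hb⟩ := hφ.bdd
  refine ⟨2 * (B * (2 + 4 * c)), by positivity, ?_⟩
  intro u hu h0 y0 s t ht hy m hm0 hm1 hN
  set y := y0 + c * (t - s) with hydef
  have hS : Sm (fun x t => u (x + (y0 + c * (t - s))) t * φ x) := by
    have h1 : ContDiff ℝ (⊤ : ℕ∞) (fun p : ℝ × ℝ => (p.1 + (y0 + c * (p.2 - s)), p.2)) := by fun_prop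
    have h2 := hu.smooth.comp h1
    exact h2.mul (hφ.smooth.comp contDiff_fst)
  have hd := param hS (-1) 1 t
  refine ⟨_, hd, ?_⟩
  have e1 : ∫ x in (-1:ℝ)..1, pt (fun x t => u (x + (y0 + c * (t - s))) t * φ x) x t
      = ∫ x in (-1:ℝ)..1, (c * px u (x + y) t - px (Wf u) (x + y) t) * φ x := by
    refine intervalIntegral.integral_congr fun x hx => ?_
    rw [uIcc_of_le (by norm_num)] at hx
    have hl : HasDerivAt (fun r : ℝ => (x + (y0 + c * (r - s)), r)) (c, (1:ℝ)) t := by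
      refine HasDerivAt.prodMk ?_ (hasDerivAt_id t)
      have := ((((hasDerivAt_id t).sub_const s).const_mul c).const_add y0).const_add x
      simpa using this
    have hf : HasFDerivAt (Function.uncurry u) (fderiv ℝ (Function.uncurry u) (x + y, t))
        ((fun r : ℝ => (x + (y0 + c * (r - s)), r)) t) := hu.sm.fd (x + y, t)
    have h3 := HasFDerivAt.comp_hasDerivAt (f := fun r : ℝ => (x + (y0 + c * (r - s)), r)) t hf hl
    have h4 : fderiv ℝ (Function.uncurry u) (x + y, t) (c, 1)
        = c * px u (x + y) t + pt u (x + y) t := by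
      have a1 := (hu.sm.hx' (x + y) t).deriv
      have a2 := (hu.sm.ht' (x + y) t).deriv
      have a3 : px u (x + y) t = fderiv ℝ (Function.uncurry u) (x + y, t) (1, 0) := a1
      have a4 : pt u (x + y) t = fderiv ℝ (Function.uncurry u) (x + y, t) (0, 1) := a2
      rw [a3, a4, ← smul_eq_mul, ← map_smul, ← map_add]
      congr 1; simp
    rw [h4, hu.eq' (by linarith [hx.2]) ht] at h3
    have h5 := (h3.mul_const (φ x)).deriv
    refine Eq.trans h5 ?_
    ring
  rw [e1, ibp_u hu.sm hφ]
  have hQ := ibp_Q hc hφ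
  have p1 := hφ.c1.continuous
  have p3 := hφ.c3.continuous
  have q := Qsol_cont (c := c)
  have q0 : Continuous fun x => u (x + y) t :=
    (hu.sm.contx t).comp (by fun_prop : Continuous fun x : ℝ => x + y)
  have i2 : Continuous fun x => (u (x + y) t ^ 2 - c * u (x + y) t) * deriv φ x
      + u (x + y) t * deriv (deriv (deriv φ)) x :=
    (((q0.pow 2).sub (continuous_const.mul q0)).mul p1).add (q0.mul p3)
  have i3 : Continuous fun x => (Qsol c x ^ 2 - c * Qsol c x) * deriv φ x
      + Qsol c x * deriv (deriv (deriv φ)) x := by fun_prop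
  rw [← sub_zero (∫ x in (-1:ℝ)..1, _), ← hQ, ← intervalIntegral.integral_sub
    (i2.intervalIntegrable _ _) (i3.intervalIntegrable _ _)]
  have := intervalIntegral.norm_integral_le_of_norm_le_const (a := -1) (b := 1)
    (C := B * (2 + 4 * c) * m)
    (f := fun x => (u (x + y) t ^ 2 - c * u (x + y) t) * deriv φ x
      + u (x + y) t * deriv (deriv (deriv φ)) x - ((Qsol c x ^ 2 - c * Qsol c x) * deriv φ x
      + Qsol c x * deriv (deriv (deriv φ)) x)) ?_
  · rw [Real.norm_eq_abs] at this
    refine this.trans ?_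
    norm_num
    linarith
  · intro x hx
    rw [uIoc_of_le (by norm_num)] at hx
    obtain ⟨-, b1, b3⟩ := hb x ⟨hx.1.le, hx.2⟩
    have hv := NN_sup hc (hu.hk h0 ht) y (x + y)
    rw [add_sub_cancel_right, wt_neg u t (x + y) (by linarith [hx.2])] at hv
    have hv' : |u (x + y) t - Qsol c x| ≤ m := abs_le_of_sq_le_sq (hv.trans hN) hm0
    set U := u (x + y) t
    set Q := Qsol c x with hQd
    have hQ0 : 0 < Q := Qsol_pos hc x
    have hQ1 : Q ≤ 3 * c / 2 := Qsol_le hc x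
    have e : (U ^ 2 - c * U) * deriv φ x + U * deriv (deriv (deriv φ)) x
        - ((Q ^ 2 - c * Q) * deriv φ x + Q * deriv (deriv (deriv φ)) x)
        = (U - Q) * ((U - Q) + 2 * Q - c) * deriv φ x + (U - Q) * deriv (deriv (deriv φ)) x := by ring
    rw [e, Real.norm_eq_abs]
    have f1 : |(U - Q) + 2 * Q - c| ≤ 1 + 4 * c := by
      have := abs_le.1 hv'
      rw [abs_le]; constructor <;> linarith
    have f2 : |(U - Q) * ((U - Q) + 2 * Q - c) * deriv φ x| ≤ m * (1 + 4 * c) * B := by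
      rw [abs_mul, abs_mul]
      exact mul_le_mul (mul_le_mul hv' f1 (abs_nonneg _) hm0) b1 (abs_nonneg _) (by positivity)
    have f3 : |(U - Q) * deriv (deriv (deriv φ)) x| ≤ m * B := by
      rw [abs_mul]; exact mul_le_mul hv' b3 (abs_nonneg _) hm0
    refine (abs_add_le _ _).trans ?_
    linarith

theorem hh_J {c : ℝ} (hc : 0 < c) {φ : ℝ → ℝ} (hφ : Phi φ) : ∃ B > 0, ∀ (u : ℝ → ℝ → ℝ),
    LeftKdVSolution u (Iic 0) → (∀ t ≤ (0:ℝ), u 0 t = 0) → ∀ (y : ℝ → ℝ) (t z : ℝ), t ≤ 0 →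
      y t < -1 → ∀ m : ℝ, 0 ≤ m → NN c (wt u t) (wd u t) (y t + z) ≤ m ^ 2 →
      |hh u φ y t - JJ c φ z| ≤ B * m := by
  obtain ⟨B, hB, hb⟩ := hφ.bdd
  refine ⟨2 * B, by positivity, ?_⟩
  intro u hu h0 y t z ht hy m hm hN
  have q0 : Continuous fun x => u (x + y t) t * φ x :=
    ((hu.sm.contx t).comp (by fun_prop : Continuous fun x : ℝ => x + y t)).mul hφ.smooth.continuous
  have q1 : Continuous fun x => Qsol c (x - z) * φ x :=
    (Qsol_cont.comp (by fun_prop : Continuous fun x : ℝ => x - z)).mul hφ.smooth.continuous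
  unfold hh JJ
  rw [← intervalIntegral.integral_sub (q0.intervalIntegrable _ _) (q1.intervalIntegrable _ _)]
  have := intervalIntegral.norm_integral_le_of_norm_le_const (a := -1) (b := 1)
    (C := m * B) (f := fun x => u (x + y t) t * φ x - Qsol c (x - z) * φ x) ?_
  · rw [Real.norm_eq_abs] at this
    refine this.trans ?_
    norm_num
    linarith
  · intro x hx
    rw [uIoc_of_le (by norm_num)] at hx
    obtain ⟨b0, -, -⟩ := hb x ⟨hx.1.le, hx.2⟩
    have hv := NN_sup hc (hu.hk h0 ht) (y t + z) (x + y t)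
    rw [show x + y t - (y t + z) = x - z by ring, wt_neg u t (x + y t) (by linarith [hx.2])] at hv
    have hv' : |u (x + y t) t - Qsol c (x - z)| ≤ m := abs_le_of_sq_le_sq (hv.trans hN) hm
    rw [← sub_mul, Real.norm_eq_abs, abs_mul]
    exact mul_le_mul hv' b0 (abs_nonneg _) hm


theorem bootstrap {n : ℝ → ℝ} {a s M : ℝ} (hn : ContinuousOn n (Icc a s)) (hs : n s < M)
    (H : ∀ t ∈ Icc a s, (∀ r ∈ Icc t s, n r ≤ M) → n t < M) : ∀ t ∈ Icc a s, n t < M := by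
  by_contra hcon
  push Not at hcon
  obtain ⟨t0, ht0, hM⟩ := hcon
  have hcl : IsClosed (Icc a s ∩ n ⁻¹' (Ici M)) := hn.preimage_isClosed_of_isClosed isClosed_Icc isClosed_Ici
  have hcp : IsCompact (Icc a s ∩ n ⁻¹' (Ici M)) := isCompact_Icc.of_isClosed_subset hcl inter_subset_left
  obtain ⟨t, ⟨ht, htM⟩, hmax⟩ := hcp.exists_isGreatest ⟨t0, ht0, hM⟩
  have htM' : M ≤ n t := htM
  have hle : ∀ r ∈ Icc t s, n r ≤ M := by
    intro r hr
    rcases hr.1.eq_or_lt with h | h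
    · subst h
      obtain ⟨q, hq, he⟩ := intermediate_value_Icc' ht.2
        (hn.mono (Icc_subset_Icc ht.1 le_rfl)) ⟨hs.le, htM'⟩
      have := hmax (show q ∈ Icc a s ∩ n ⁻¹' (Ici M) from ⟨⟨ht.1.trans hq.1, hq.2⟩, he.ge⟩)
      have e : q = t := le_antisymm this hq.1
      rw [← e, he]
    · by_contra hc
      push Not at hc
      have := hmax (show r ∈ Icc a s ∩ n ⁻¹' (Ici M) from ⟨⟨ht.1.trans hr.1, hr.2⟩, hc.le⟩)
      linarith
  linarith [H t ht hle]

theorem NN_cont {c : ℝ} (hc : 0 < c) {u : ℝ → ℝ → ℝ} (hu : LeftKdVSolution u (Iic 0))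
    (y0 s a : ℝ) : ContinuousOn
      (fun t => NN c (wt u t) (wd u t) (y0 + c * (t - s))) (Icc a 0) := by
  obtain ⟨g, hg, hb⟩ := hu.unif' a
  have hyc : Continuous (fun t : ℝ => y0 + c * (t - s)) := by fun_prop
  obtain ⟨Y, hY⟩ := isCompact_Icc.exists_bound_of_continuousOn (s := Icc a 0) hyc.continuousOn
  set k := Real.sqrt c with hk
  have hk0 : 0 < k := Real.sqrt_pos.2 hc
  set G := fun x : ℝ => 6 * c * Real.exp (k * Y) * Real.exp (-(k * |x|)) with hG
  have hGQ : ∀ t ∈ Icc a 0, ∀ x, Qsol c (x - (y0 + c * (t - s))) ≤ G x := by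
    intro t ht x
    refine (Qsol_exp hc _).trans ?_
    rw [hG]
    simp only
    rw [mul_assoc, mul_assoc, ← Real.exp_add, ← mul_assoc (6:ℝ)]
    refine mul_le_mul_of_nonneg_left (Real.exp_le_exp.2 ?_) (by positivity)
    have h1 := hY t ht
    rw [Real.norm_eq_abs] at h1
    have h2 := abs_sub_abs_le_abs_sub x (y0 + c * (t - s))
    have h3 : k * (|x| - Y) ≤ k * |x - (y0 + c * (t - s))| :=
      mul_le_mul_of_nonneg_left (by linarith) hk0.le
    rw [← hk]
    linarith
  have hGi : Integrable G := (exp_abs_integrable hk0).const_mul _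
  unfold NN
  refine continuousOn_of_dominated
    (bound := fun x => (Iio 0).indicator (fun x => 4 * g x) x + (2 + 2 * c) * (3 * c / 2) * G x)
    ?_ ?_ ?_ ?_
  · intro t ht
    have m1 : Measurable (wt u t) := ((hu.sm.contx t).measurable).indicator measurableSet_Iio
    have m2 : Measurable (wd u t) := ((hu.sm.px.contx t).measurable).indicator measurableSet_Iio
    have m3 : Measurable fun x => Qsol c (x - (y0 + c * (t - s))) :=
      (Qsol_cont.comp (by fun_prop)).measurable
    have m4 : Measurable fun x => qd c (x - (y0 + c * (t - s))) :=
      ((qd_cont hc).comp (by fun_prop)).measurable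
    exact (((m1.sub m3).pow_const 2).add ((m2.sub m4).pow_const 2)).aestronglyMeasurable
  · intro t ht
    refine ae_of_all _ fun x => ?_
    rw [Real.norm_eq_abs, abs_of_nonneg (by positivity)]
    set q := Qsol c (x - (y0 + c * (t - s))) with hq
    set p := qd c (x - (y0 + c * (t - s))) with hp
    have q0 : 0 < q := Qsol_pos hc _
    have q1 : q ≤ 3 * c / 2 := Qsol_le hc _
    have q2 : q ≤ G x := hGQ t ht x
    have p2 : p ^ 2 ≤ c * q ^ 2 := by
      rw [hp, qd_sq hc]
      have : 0 < q ^ 3 := by positivity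
      linarith
    have qq : q ^ 2 ≤ (3 * c / 2) * G x := by
      rw [sq]; exact mul_le_mul q1 q2 q0.le (by positivity)
    have cqq := mul_le_mul_of_nonneg_left qq hc.le
    have hw : wt u t x ^ 2 + wd u t x ^ 2 ≤ (Iio 0).indicator (fun x => 2 * g x) x := by
      rcases lt_or_ge x 0 with h | h
      · rw [wt_neg u t x h, wd_neg u t x h, indicator_of_mem (show x ∈ Iio 0 from h)]
        have := hb t ht x h
        linarith [this.1.2, this.2.1.2]
      · rw [wt_zero u t x h, wd_zero u t x h, indicator_of_notMem (by simpa using h)]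
        norm_num
    have hi : (Iio 0).indicator (fun x => 4 * g x) x = 2 * (Iio 0).indicator (fun x => 2 * g x) x := by
      rcases lt_or_ge x 0 with h | h
      · rw [indicator_of_mem (show x ∈ Iio 0 from h), indicator_of_mem (show x ∈ Iio 0 from h)]; ring
      · rw [indicator_of_notMem (by simpa using h), indicator_of_notMem (by simpa using h)]; ring
    rw [hi]
    have s1 := sq_nonneg (wt u t x + q)
    have s2 := sq_nonneg (wd u t x + p)
    nlinarith
  · exact ((integrable_indicator_iff measurableSet_Iio).2 (hg.const_mul 4)).add (hGi.const_mul _)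
  · refine ae_of_all _ fun x => Continuous.continuousOn ?_
    have m1 : Continuous fun t => wt u t x := by
      rcases lt_or_ge x 0 with h | h
      · simp only [wt_neg u _ x h]; exact hu.sm.contt x
      · simp only [wt_zero u _ x h]; exact continuous_const
    have m2 : Continuous fun t => wd u t x := by
      rcases lt_or_ge x 0 with h | h
      · simp only [wd_neg u _ x h]; exact hu.sm.px.contt x
      · simp only [wd_zero u _ x h]; exact continuous_const
    have m3 : Continuous fun t => Qsol c (x - (y0 + c * (t - s))) :=
      Qsol_cont.comp (by fun_prop)
    have m4 : Continuous fun t => qd c (x - (y0 + c * (t - s))) :=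
      (qd_cont hc).comp (by fun_prop)
    exact ((m1.sub m3).pow 2).add ((m2.sub m4).pow 2)


theorem step {c : ℝ} (hc : 0 < c) : ∃ K1 K2 K3 τ ε0 : ℝ, 0 < K1 ∧ 0 < K2 ∧ 0 < K3 ∧ 0 < τ ∧ 0 < ε0 ∧
    ∀ (u : ℝ → ℝ → ℝ), LeftKdVSolution u (Iic 0) → (∀ t ≤ (0:ℝ), u 0 t = 0) →
    ∀ e : ℝ, 0 < e → e ≤ ε0 → ∀ y00, NN c (wt u 0) (wd u 0) y00 ≤ e ^ 2 →
    (∃ y', |y' - y00| ≤ 1 ∧ NN c (wt u 0) (wd u 0) y' ≤ (K1 * e) ^ 2) ∧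
    ∀ s ≤ (0:ℝ), ∀ ys, NN c (wt u s) (wd u s) ys ≤ (K1 * e) ^ 2 →
      (∀ t ∈ Icc (s - τ) s, NN c (wt u t) (wd u t) (ys + c * (t - s)) ≤ (K2 * e) ^ 2) ∧
      ∃ y', |y' - (ys + c * (-τ))| ≤ K3 * e ∧
        NN c (wt u (s - τ)) (wd u (s - τ)) y' ≤ (K1 * e) ^ 2 := by
  obtain ⟨K1, hK1, Hst⟩ := stab hc
  obtain ⟨φ, hφ⟩ := exists_phi
  obtain ⟨κ, hκ, z0, hz0, HJ⟩ := Jlow hc hφ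
  obtain ⟨K, hK, Hd⟩ := hh_deriv hc hφ
  obtain ⟨B, hB, HB⟩ := hh_J hc hφ
  obtain ⟨V, hV, HV⟩ := NN_move hc
  obtain ⟨δ, hδ, Hs⟩ := Hst (min z0 1) (lt_min hz0 one_pos)
  set P := 2 * B * K1 / κ with hP
  have hP0 : 0 < P := by positivity
  set θ := 1 / (4 * (V + 1)) with hθ
  have hθ0 : 0 < θ := by positivity
  have hVθ : V * θ ^ 2 ≤ 1 / 16 := by
    rw [hθ, div_pow, mul_div_assoc', div_le_div_iff₀ (by positivity) (by norm_num)]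
    nlinarith
  set τ := θ * κ / K with hτ
  have hτ0 : 0 < τ := by positivity
  set K2 := Real.sqrt (8 * K1 ^ 2 + 8 * (V * P ^ 2)) with hK2
  have hK2s : K2 ^ 2 = 8 * K1 ^ 2 + 8 * (V * P ^ 2) := Real.sq_sqrt (by positivity)
  have hK20 : 0 < K2 := Real.sqrt_pos.2 (by positivity)
  set q := Qsol c 1 with hq
  have hq0 : 0 < q := Qsol_pos hc 1
  set r := min (min 1 (Real.sqrt δ)) (q / 2) with hr
  have hr0 : 0 < r := lt_min (lt_min one_pos (Real.sqrt_pos.2 hδ)) (by linarith)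
  have r1 : r ≤ 1 := (min_le_left _ _).trans (min_le_left _ _)
  have r2 : r ≤ Real.sqrt δ := (min_le_left _ _).trans (min_le_right _ _)
  have r3 : r ≤ q / 2 := min_le_right _ _
  refine ⟨K1, K2, P + θ * K2, τ, min 1 (min (r / K2) (Real.sqrt δ)), hK1, hK20, by positivity, hτ0,
    lt_min one_pos (lt_min (by positivity) (Real.sqrt_pos.2 hδ)), ?_⟩
  intro u hu h0 e he hee y00 hN0
  have e1 : e ≤ 1 := hee.trans (min_le_left _ _)
  have e2 : K2 * e ≤ r := by
    have : e ≤ r / K2 := hee.trans ((min_le_right _ _).trans (min_le_left _ _))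
    rw [le_div_iff₀ hK20] at this; linarith
  have e3 : e ≤ Real.sqrt δ := hee.trans ((min_le_right _ _).trans (min_le_right _ _))
  have sqδ : Real.sqrt δ ^ 2 = δ := Real.sq_sqrt hδ.le
  have m0 : 0 < K2 * e := by positivity
  have hM1 : (K2 * e) ^ 2 ≤ δ := by
    rw [← sqδ]; exact pow_le_pow_left₀ m0.le (e2.trans r2) 2
  have hMq : (K2 * e) ^ 2 < q ^ 2 := pow_lt_pow_left₀ (by linarith) m0.le (by norm_num)
  have stb : ∀ t ≤ (0:ℝ), ∀ y0, NN c (wt u t) (wd u t) y0 ≤ δ →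
      ∃ y, |y - y0| ≤ min z0 1 ∧ NN c (wt u t) (wd u t) y ≤ (K1 * e) ^ 2 := by
    intro t ht y0 hy0
    exact Hs e _ _ y00 he.le e1 (hu.hk h0 le_rfl) hN0 _ _ y0 (hu.hk h0 ht) (wt_zero u t)
      (mass_mono hu h0 ht) (energy_mono hu h0 ht) hy0
  refine ⟨?_, ?_⟩
  · obtain ⟨y, hy, hy'⟩ := stb 0 le_rfl y00 (hN0.trans (by
      rw [← sqδ]; exact pow_le_pow_left₀ he.le e3 2))
    exact ⟨y, hy.trans (min_le_right _ _), hy'⟩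
  intro s hs ys hNs
  set n := fun t => NN c (wt u t) (wd u t) (ys + c * (t - s)) with hn
  have hns : n s ≤ (K1 * e) ^ 2 := by
    rw [hn]; simp only [sub_self, mul_zero, add_zero]; exact hNs
  have hVP : 0 ≤ V * P ^ 2 := by positivity
  have he2 : 0 < e ^ 2 := by positivity
  have claim : ∀ t ∈ Icc (s - τ) s, (∀ r ∈ Icc t s, n r ≤ (K2 * e) ^ 2) →
      ∃ y', |y' - (ys + c * (t - s))| ≤ (P + θ * K2) * e ∧ |y' - (ys + c * (t - s))| ≤ 1 ∧
        NN c (wt u t) (wd u t) y' ≤ (K1 * e) ^ 2 := by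
    intro t ht H
    obtain ⟨y', hy1, hy2⟩ := stb t (ht.2.trans hs) (ys + c * (t - s)) ((H t ⟨le_rfl, ht.2⟩).trans hM1)
    refine ⟨y', ?_, hy1.trans (min_le_right _ _), hy2⟩
    set Y := fun t => ys + c * (t - s) with hY
    have pos : ∀ r ∈ Icc t s, Y r < -1 := by
      intro r hr
      have := NN_pos hc (hu.hk h0 (hr.2.trans hs)) (wt_zero u r) (y := Y r) (X := 1)
        (lt_of_le_of_lt (H r hr) hMq)
      linarith
    have hder : ∀ r ∈ Icc t s, ∃ d, HasDerivAt (hh u φ Y) d r ∧ |d| ≤ K * (K2 * e) := by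
      intro r hr
      exact Hd u hu h0 ys s r (hr.2.trans hs) (pos r hr) (K2 * e) m0.le (e2.trans r1) (H r hr)
    choose! d hd hdb using hder
    have mvt := (convex_Icc t s).norm_image_sub_le_of_norm_hasDerivWithin_le
      (f := hh u φ Y) (f' := d) (C := K * (K2 * e)) (x := s) (y := t)
      (fun r hr => (hd r hr).hasDerivWithinAt) (fun r hr => hdb r hr) ⟨ht.2, le_rfl⟩ ⟨le_rfl, ht.2⟩
    rw [Real.norm_eq_abs, Real.norm_eq_abs] at mvt
    have ab : |t - s| ≤ τ := by
      rw [abs_le]; constructor <;> linarith [ht.1, ht.2]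
    have mvt2 : |hh u φ Y t - hh u φ Y s| ≤ K * (K2 * e) * τ :=
      mvt.trans (mul_le_mul_of_nonneg_left ab (by positivity))
    have a1 := HB u hu h0 Y t (y' - Y t) (ht.2.trans hs) (pos t ⟨le_rfl, ht.2⟩) (K1 * e) (by positivity)
      (by rw [add_sub_cancel]; exact hy2)
    have a2 := HB u hu h0 Y s 0 hs (pos s ⟨ht.2, le_rfl⟩) (K1 * e) (by positivity)
      (by rw [add_zero]; exact hns)
    have a3 := HJ (y' - Y t) (hy1.trans (min_le_left _ _))
    have a4 : |JJ c φ (y' - Y t) - JJ c φ 0| ≤ B * (K1 * e) + K * (K2 * e) * τ + B * (K1 * e) := by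
      have := abs_le.1 a1
      have := abs_le.1 a2
      have := abs_le.1 mvt2
      rw [abs_le]; constructor <;> linarith
    have a5 : (P + θ * K2) * e * κ = B * (K1 * e) + K * (K2 * e) * τ + B * (K1 * e) := by
      rw [hP, hτ]; field_simp; ring
    have a6 : κ * |y' - Y t| ≤ κ * ((P + θ * K2) * e) := by linarith
    exact le_of_mul_le_mul_left a6 hκ
  have boot : ∀ t ∈ Icc (s - τ) s, n t < (K2 * e) ^ 2 := by
    apply bootstrap
    · exact (NN_cont hc hu ys s (s - τ)).mono (Icc_subset_Icc le_rfl hs)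
    · refine lt_of_le_of_lt hns ?_
      rw [mul_pow, mul_pow, hK2s]
      refine mul_lt_mul_of_pos_right ?_ he2
      have : 0 < K1 ^ 2 := by positivity
      linarith
    · intro t ht H
      obtain ⟨y', h1, h2, h3⟩ := claim t ht H
      have h4 := HV 0 _ _ (hu.hk h0 (ht.2.trans hs)) (ys + c * (t - s)) y' (by rwa [abs_sub_comm])
      have h5 : (ys + c * (t - s) - y') ^ 2 ≤ ((P + θ * K2) * e) ^ 2 := by
        rw [← sq_abs, abs_sub_comm]
        exact pow_le_pow_left₀ (abs_nonneg _) h1 2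
      have h6 : ((P + θ * K2) * e) ^ 2 ≤ (2 * P ^ 2 + 2 * θ ^ 2 * K2 ^ 2) * e ^ 2 := by
        rw [mul_pow]
        refine mul_le_mul_of_nonneg_right ?_ he2.le
        nlinarith [sq_nonneg (P - θ * K2)]
      have h7 := mul_le_mul_of_nonneg_left (h5.trans h6) hV.le
      have h8 : V * θ ^ 2 * (K2 ^ 2 * e ^ 2) ≤ 1 / 16 * (K2 ^ 2 * e ^ 2) :=
        mul_le_mul_of_nonneg_right hVθ (by positivity)
      have h9 : 0 < K2 ^ 2 * e ^ 2 := by positivity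
      have h10 : K2 ^ 2 * e ^ 2 = 8 * (K1 ^ 2 * e ^ 2) + 8 * (V * P ^ 2 * e ^ 2) := by
        rw [hK2s]; ring
      rw [mul_pow] at h3
      rw [mul_pow]
      have h11 : V * ((2 * P ^ 2 + 2 * θ ^ 2 * K2 ^ 2) * e ^ 2)
        = 2 * (V * P ^ 2 * e ^ 2) + 2 * (V * θ ^ 2 * (K2 ^ 2 * e ^ 2)) := by ring
      change NN c (wt u t) (wd u t) (ys + c * (t - s)) < _
      linarith
  refine ⟨fun t ht => (boot t ht).le, ?_⟩
  obtain ⟨y', h1, -, h3⟩ := claim (s - τ) ⟨le_rfl, by linarith⟩ (fun r hr => (boot r hr).le)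
  refine ⟨y', ?_, h3⟩
  rwa [show s - τ - s = -τ by ring] at h1


theorem half_le {c : ℝ} (hc : 0 < c) {u : ℝ → ℝ → ℝ} (hu : LeftKdVSolution u (Iic 0))
    (h0 : ∀ t ≤ (0:ℝ), u 0 t = 0) {t : ℝ} (ht : t ≤ 0) (y : ℝ) :
    ∫ x in Iio (0:ℝ), ((u x t - Qsol c (x - y)) ^ 2 + (px u x t - qd c (x - y)) ^ 2)
      ≤ NN c (wt u t) (wd u t) y := by
  have i1 := ((hu.hk h0 ht).sub (HK_Qy hc 0 y)).energy
  have e : ∫ x in Iio (0:ℝ), ((u x t - Qsol c (x - y)) ^ 2 + (px u x t - qd c (x - y)) ^ 2)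
      = ∫ x in Iio (0:ℝ), ((wt u t x - Qsol c (x - y)) ^ 2 + (wd u t x - qd c (x - y)) ^ 2) := by
    refine setIntegral_congr_fun measurableSet_Iio fun x hx => ?_
    rw [wt_neg u t x hx, wd_neg u t x hx]
  rw [e]
  exact setIntegral_le_integral i1 (ae_of_all _ fun x => by positivity)

theorem initial_bound {c : ℝ} (hc : 0 < c) : ∃ K : ℝ, 0 < K ∧ ∀ (u : ℝ → ℝ → ℝ),
    LeftKdVSolution u (Iic 0) → (∀ t ≤ (0:ℝ), u 0 t = 0) → ∀ α L : ℝ, 0 < α → 0 < L →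
    Real.sqrt (∫ x in Iio (0 : ℝ), ((u x 0 - Qsol c (x + L)) ^ 2
                + (deriv (fun y => u y 0) x - deriv (Qsol c) (x + L)) ^ 2)) < α →
    NN c (wt u 0) (wd u 0) (-L) ≤ (K * (α + Real.exp (-Real.sqrt c * L))) ^ 2 := by
  set k := Real.sqrt c with hk
  have hk0 : 0 < k := Real.sqrt_pos.2 hc
  set I := ∫ x : ℝ, Real.exp (-(k * |x|)) with hI
  have hI0 : 0 ≤ I := integral_nonneg fun x => (Real.exp_pos _).le
  set A := (1 + c) * (6 * c) ^ 2 with hA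
  have hA0 : 0 < A := by positivity
  refine ⟨1 + A * I, by positivity, ?_⟩
  intro u hu h0 α L hα hL hs
  set E := Real.exp (-k * L) with hE
  have hE0 : 0 < E := Real.exp_pos _
  rw [Real.sqrt_lt' hα, Qsol_deriv] at hs
  have i1 := ((hu.hk h0 le_rfl).sub (HK_Qy hc 0 (-L))).energy
  have split := integral_add_compl (measurableSet_Iio (a := (0:ℝ))) i1
  have e1 : ∫ x in Iio (0:ℝ), ((wt u 0 x - Qsol c (x - -L)) ^ 2 + (wd u 0 x - qd c (x - -L)) ^ 2)
      = ∫ x in Iio (0 : ℝ), ((u x 0 - Qsol c (x + L)) ^ 2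
                + (deriv (fun y => u y 0) x - qd c (x + L)) ^ 2) := by
    refine setIntegral_congr_fun measurableSet_Iio fun x hx => ?_
    rw [wt_neg u 0 x hx, wd_neg u 0 x hx, sub_neg_eq_add]; rfl
  have i2 : Integrable (fun x : ℝ => A * E ^ 2 * Real.exp (-(k * |x|))) :=
    (exp_abs_integrable hk0).const_mul _
  have e2 : ∫ x in (Iio (0:ℝ))ᶜ, ((wt u 0 x - Qsol c (x - -L)) ^ 2 + (wd u 0 x - qd c (x - -L)) ^ 2)
      ≤ A * E ^ 2 * I := by
    calc _ ≤ ∫ x in (Iio (0:ℝ))ᶜ, A * E ^ 2 * Real.exp (-(k * |x|)) := by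
          refine setIntegral_mono_on i1.integrableOn i2.integrableOn measurableSet_Iio.compl
            fun x hx => ?_
          have hx0 : 0 ≤ x := by simpa using hx
          rw [wt_zero u 0 x hx0, wd_zero u 0 x hx0, sub_neg_eq_add, zero_sub, zero_sub, neg_sq, neg_sq]
          have q0 := Qsol_pos hc (x + L)
          have q1 := Qsol_exp hc (x + L)
          rw [← hk, abs_of_nonneg (by linarith : 0 ≤ x + L)] at q1
          have q2 : qd c (x + L) ^ 2 ≤ c * Qsol c (x + L) ^ 2 := by
            rw [qd_sq hc]
            have : 0 < Qsol c (x + L) ^ 3 := by positivity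
            linarith
          have q3 : Qsol c (x + L) ^ 2 ≤ (6 * c) ^ 2 * (E ^ 2 * Real.exp (-(k * |x|))) := by
            have := pow_le_pow_left₀ q0.le q1 2
            refine this.trans ?_
            rw [mul_pow]
            refine mul_le_mul_of_nonneg_left ?_ (by positivity)
            rw [hE, ← Real.exp_nat_mul, ← Real.exp_nat_mul, ← Real.exp_add, abs_of_nonneg hx0]
            apply Real.exp_le_exp.2
            push_cast
            nlinarith [mul_nonneg hk0.le hx0]
          have q4 := mul_le_mul_of_nonneg_left q3 (by positivity : 0 ≤ 1 + c)
          rw [hA]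
          linarith
      _ ≤ ∫ x, A * E ^ 2 * Real.exp (-(k * |x|)) :=
          setIntegral_le_integral i2 (ae_of_all _ fun x => by positivity)
      _ = A * E ^ 2 * I := by rw [integral_const_mul]
  have e3 : NN c (wt u 0) (wd u 0) (-L) ≤ α ^ 2 + A * E ^ 2 * I := by
    unfold NN
    rw [← split, e1]
    linarith
  have hAI : 0 ≤ A * I := by positivity
  have e4 : α ^ 2 + A * E ^ 2 * I ≤ (1 + A * I) * (α + E) ^ 2 := by
    have : 0 ≤ α * E := by positivity
    have h1 : α ^ 2 ≤ (α + E) ^ 2 := by nlinarith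
    have h2 : E ^ 2 ≤ (α + E) ^ 2 := by nlinarith
    have := mul_le_mul_of_nonneg_left h2 hAI
    linarith
  have e5 : (1 + A * I) * (α + E) ^ 2 ≤ (1 + A * I) ^ 2 * (α + E) ^ 2 := by
    refine mul_le_mul_of_nonneg_right ?_ (sq_nonneg _)
    nlinarith
  rw [mul_pow]
  linarith

theorem st_zero {z : ℝ} (hz : z ≤ 0 ∨ 1 ≤ z) : deriv Real.smoothTransition z = 0 := by
  rcases hz with h | h
  · apply IsLocalMin.deriv_eq_zero
    refine Eventually.of_forall fun y => ?_
    rw [Real.smoothTransition.zero_of_nonpos h]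
    exact Real.smoothTransition.nonneg y
  · apply IsLocalMax.deriv_eq_zero
    refine Eventually.of_forall fun y => ?_
    rw [Real.smoothTransition.one_of_one_le h]
    exact Real.smoothTransition.le_one y

theorem st_bdd : ∃ D > 0, ∀ z, |deriv Real.smoothTransition z| ≤ D := by
  have hc : Continuous (deriv Real.smoothTransition) :=
    (Real.smoothTransition.contDiff (n := 1)).continuous_deriv le_rfl
  obtain ⟨B, hB⟩ := isCompact_Icc.exists_bound_of_continuousOn (s := Icc (0:ℝ) 1) hc.continuousOn
  refine ⟨|B| + 1, by positivity, fun z => ?_⟩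
  by_cases h : z ∈ Icc (0:ℝ) 1
  · have := hB z h
    rw [Real.norm_eq_abs] at this
    linarith [le_abs_self B]
  · rw [st_zero, abs_zero]
    · positivity
    · by_contra hh
      push Not at hh
      exact h ⟨hh.1.le, hh.2.le⟩

theorem interp : ∃ D > 0, ∀ (E : ℕ → ℝ) (b : ℝ), (∀ n, |E n| ≤ b) → ∃ S : ℝ → ℝ,
    ContDiff ℝ 1 S ∧ (∀ x, |deriv S x| ≤ D * b) ∧
    ∀ (n : ℕ) (x : ℝ), (n:ℝ) ≤ x → x ≤ n + 1 → |S x - ∑ i ∈ Finset.range n, E i| ≤ b := by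
  obtain ⟨D, hD, HD⟩ := st_bdd
  refine ⟨D, hD, fun E b hE => ?_⟩
  have hb : 0 ≤ b := (abs_nonneg _).trans (hE 0)
  set S := fun x : ℝ => ∑ i ∈ Finset.range ⌈x⌉₊, E i * Real.smoothTransition (x - i) with hS
  have key : ∀ (N : ℕ) (x : ℝ), x ≤ N →
      S x = ∑ i ∈ Finset.range N, E i * Real.smoothTransition (x - i) := by
    intro N x hx
    rw [hS]
    apply Finset.sum_subset
    · intro i hi
      rw [Finset.mem_range] at hi ⊢
      exact lt_of_lt_of_le hi (Nat.ceil_le.2 hx)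
    · intro i _ hi
      rw [Finset.mem_range, not_lt] at hi
      rw [Real.smoothTransition.zero_of_nonpos, mul_zero]
      have := Nat.ceil_le.1 hi
      linarith
  have loc : ∀ x : ℝ, S =ᶠ[nhds x] fun y => ∑ i ∈ Finset.range (⌈x⌉₊ + 1),
      E i * Real.smoothTransition (y - i) := by
    intro x
    have h1 : x < ((⌈x⌉₊ + 1 : ℕ) : ℝ) := by
      push_cast; linarith [Nat.le_ceil x]
    filter_upwards [Iio_mem_nhds h1] with y hy
    exact key _ y (le_of_lt hy)
  refine ⟨S, ?_, ?_, ?_⟩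
  · rw [contDiff_iff_contDiffAt]
    intro x
    refine ContDiffAt.congr_of_eventuallyEq ?_ (loc x)
    refine ContDiff.contDiffAt (ContDiff.sum fun i _ => contDiff_const.mul ?_)
    exact Real.smoothTransition.contDiff.comp (by fun_prop)
  · intro x
    rw [(loc x).deriv_eq]
    have hd : HasDerivAt (fun y => ∑ i ∈ Finset.range (⌈x⌉₊ + 1),
      E i * Real.smoothTransition (y - i))
      (∑ i ∈ Finset.range (⌈x⌉₊ + 1), E i * deriv Real.smoothTransition (x - i)) x := by
      refine HasDerivAt.fun_sum fun i _ => ?_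
      have h1 : HasDerivAt Real.smoothTransition (deriv Real.smoothTransition (x - i)) (x - i) :=
        ((Real.smoothTransition.contDiff (n := 1)).differentiable (by simp) _).hasDerivAt
      exact (h1.comp_sub_const x i).const_mul (E i)
    rw [hd.deriv, Finset.sum_eq_single ⌊x⌋₊]
    · rw [abs_mul, mul_comm]
      exact mul_le_mul (HD _) (hE _) (abs_nonneg _) hD.le
    · intro i _ hi
      rw [st_zero, mul_zero]
      rcases lt_or_gt_of_ne hi with h | h
      · right
        have h2 : i + 1 ≤ ⌊x⌋₊ := h
        have := (Nat.le_floor_iff' (by omega)).1 h2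
        push_cast at this
        linarith
      · left
        have h2 : ⌊x⌋₊ + 1 ≤ i := h
        have h3 : ((⌊x⌋₊ + 1 : ℕ) : ℝ) ≤ i := Nat.cast_le.2 h2
        push_cast at h3
        linarith [Nat.lt_floor_add_one x]
    · intro h
      exfalso; apply h
      rw [Finset.mem_range]
      exact Nat.lt_succ_of_le (Nat.floor_le_ceil x)
  · intro n x h1 h2
    rw [key (n + 1) x (by push_cast; exact h2), Finset.sum_range_succ]
    have e : ∑ i ∈ Finset.range n, E i * Real.smoothTransition (x - i) = ∑ i ∈ Finset.range n, E i := by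
      refine Finset.sum_congr rfl fun i hi => ?_
      rw [Real.smoothTransition.one_of_one_le, mul_one]
      have h3 : i + 1 ≤ n := Finset.mem_range.1 hi
      have h4 : ((i + 1 : ℕ) : ℝ) ≤ n := Nat.cast_le.2 h3
      push_cast at h4
      linarith
    rw [e, add_sub_cancel_left, abs_mul]
    have := Real.smoothTransition.le_one (x - n)
    rw [abs_of_nonneg (Real.smoothTransition.nonneg (x - n))]
    calc |E n| * Real.smoothTransition (x - n) ≤ |E n| * 1 :=
          mul_le_mul_of_nonneg_left this (abs_nonneg _)
      _ ≤ b := by rw [mul_one]; exact hE n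


theorem soliton_stability_left_halfline_negative_time (c : ℝ) (hc : 0 < c) :
    ∃ α₀ C₀ L₀ C : ℝ, 0 < α₀ ∧ 0 < C₀ ∧ 0 < L₀ ∧ 0 < C ∧
      ∀ α : ℝ, 0 < α → α < α₀ → ∀ L : ℝ, L > L₀ →
        ∀ u : ℝ → ℝ → ℝ, LeftKdVSolution u (Iic 0) →
          (∀ t ≤ (0 : ℝ), u 0 t = 0) →
          Real.sqrt (∫ x in Iio (0 : ℝ),
              ((u x 0 - Qsol c (x + L)) ^ 2
                + (deriv (fun y => u y 0) x - deriv (Qsol c) (x + L)) ^ 2)) < α →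
          ∃ ρ : ℝ → ℝ, ContDiff ℝ 1 ρ ∧
            (∀ t ≤ (0 : ℝ),
              Real.sqrt (∫ x in Iio (0 : ℝ),
                  ((u x t - Qsol c (x - ρ t + L)) ^ 2
                    + (deriv (fun y => u y t) x - deriv (Qsol c) (x - ρ t + L)) ^ 2))
                < C₀ * (α + Real.exp (-Real.sqrt c * L))) ∧
            (∀ t ≤ (0 : ℝ),
              |deriv ρ t - c| < C * C₀ * (α + Real.exp (-Real.sqrt c * L))) := by
  obtain ⟨K1, K2, K3, τ, ε0, hK1, hK2, hK3, hτ, hε0, Hstep⟩ := step hc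
  obtain ⟨V, hV, HV⟩ := NN_move hc
  obtain ⟨K, hK, Hinit⟩ := initial_bound hc
  obtain ⟨D, hD, Hint⟩ := interp
  set k := Real.sqrt c with hk
  have hk0 : 0 < k := Real.sqrt_pos.2 hc
  set ε1 := min ε0 (1 / K3) with hε1
  have hε10 : 0 < ε1 := lt_min hε0 (by positivity)
  set G := Real.sqrt (2 * K2 ^ 2 + V * K3 ^ 2) with hG
  have hG0 : 0 ≤ G := Real.sqrt_nonneg _
  have hG2 : G ^ 2 = 2 * K2 ^ 2 + V * K3 ^ 2 := Real.sq_sqrt (by positivity)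
  refine ⟨ε1 / (2 * K), G * K + 1, 2 * K / ε1 / k, D * K3 * K / τ + 1, by positivity, by positivity,
    by positivity, by positivity, ?_⟩
  intro α hα hα0 L hL u hu h0 hclose
  have hL0 : 0 < L := lt_trans (by positivity) hL
  set ε := α + Real.exp (-k * L) with hε
  have hexp0 : 0 < Real.exp (-k * L) := Real.exp_pos _
  have hεp : 0 < ε := by positivity
  have hexp : Real.exp (-k * L) ≤ ε1 / (2 * K) := by
    have h1 : 2 * K / ε1 < k * L := by
      have := (div_lt_iff₀ hk0).1 hL
      linarith
    have h2 := Real.add_one_le_exp (k * L)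
    have h3 : 2 * K / ε1 ≤ Real.exp (k * L) := by linarith
    rw [neg_mul, Real.exp_neg]
    have h4 := inv_anti₀ (by positivity) h3
    rwa [inv_div] at h4
  have hKε : K * ε ≤ ε1 := by
    have : ε ≤ ε1 / K := by
      have e : ε1 / (2 * K) + ε1 / (2 * K) = ε1 / K := by field_simp; norm_num
      linarith
    rw [le_div_iff₀ hK] at this
    linarith
  set e := K * ε with he
  have he0 : 0 < e := by positivity
  have he1 : K3 * e ≤ 1 := by
    have : e ≤ 1 / K3 := hKε.trans (min_le_right _ _)
    rw [le_div_iff₀ hK3] at this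
    linarith
  have hN0 := Hinit u hu h0 α L hα hL0 hclose
  obtain ⟨⟨y0, -, hy0⟩, Hs⟩ := Hstep u hu h0 e he0 (hKε.trans (min_le_left _ _)) (-L) hN0
  have hnext : ∀ (s y : ℝ), ∃ y', s ≤ 0 → NN c (wt u s) (wd u s) y ≤ (K1 * e) ^ 2 →
      |y' - (y + c * (-τ))| ≤ K3 * e ∧ NN c (wt u (s - τ)) (wd u (s - τ)) y' ≤ (K1 * e) ^ 2 := by
    intro s y
    by_cases h : s ≤ 0 ∧ NN c (wt u s) (wd u s) y ≤ (K1 * e) ^ 2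
    · obtain ⟨-, y', h1, h2⟩ := Hs s h.1 y h.2
      exact ⟨y', fun _ _ => ⟨h1, h2⟩⟩
    · exact ⟨0, fun h1 h2 => absurd ⟨h1, h2⟩ h⟩
  choose nx hnx using hnext
  let Y : ℕ → ℝ := fun n => Nat.rec y0 (fun n y => nx (-(n * τ)) y) n
  have hYs : ∀ n, Y (n + 1) = nx (-(n * τ)) (Y n) := fun n => rfl
  have htn : ∀ n : ℕ, -((n:ℝ) * τ) ≤ 0 := fun n => by
    have : 0 ≤ (n:ℝ) * τ := by positivity
    linarith
  have hY : ∀ n : ℕ, NN c (wt u (-(n * τ))) (wd u (-(n * τ))) (Y n) ≤ (K1 * e) ^ 2 := by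
    intro n
    induction n with
    | zero =>
      have z : -(((0:ℕ):ℝ) * τ) = 0 := by simp
      rw [z]; exact hy0
    | succ n ih =>
      have := (hnx (-(n * τ)) (Y n) (htn n) ih).2
      have z : -(((n + 1 : ℕ):ℝ) * τ) = -(n * τ) - τ := by push_cast; ring
      rw [z, hYs]; exact this
  obtain ⟨S, hS, hSd, hSv⟩ := Hint (fun n => Y (n + 1) - Y n + c * τ) (K3 * e) (fun n => by
    have := (hnx (-(n * τ)) (Y n) (htn n) (hY n)).1
    rw [← hYs] at this
    rwa [show Y (n + 1) - Y n + c * τ = Y (n + 1) - (Y n + c * (-τ)) by ring])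
  have hsum : ∀ n : ℕ, ∑ i ∈ Finset.range n, (Y (i + 1) - Y i + c * τ) = Y n - Y 0 + n * (c * τ) := by
    intro n
    rw [Finset.sum_add_distrib, Finset.sum_range_sub]
    simp
  refine ⟨fun t => L + Y 0 + c * t + S (-t / τ), ?_, ?_, ?_⟩
  · exact ((contDiff_const.add (contDiff_const.mul contDiff_id))).add (hS.comp (by fun_prop))
  · intro t ht
    set x := -t / τ with hx
    have hx0 : 0 ≤ x := div_nonneg (by linarith) hτ.le
    have hxt : t = -(x * τ) := by rw [hx]; field_simp
    set n := ⌊x⌋₊ with hn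
    have n1 : (n:ℝ) ≤ x := Nat.floor_le hx0
    have n2 : x ≤ n + 1 := (Nat.lt_floor_add_one x).le
    have hv := hSv n x n1 n2
    rw [hsum] at hv
    have m1 : (n:ℝ) * τ ≤ x * τ := mul_le_mul_of_nonneg_right n1 hτ.le
    have m2 : x * τ ≤ (n + 1) * τ := mul_le_mul_of_nonneg_right n2 hτ.le
    obtain ⟨Hc, -⟩ := Hs (-(n * τ)) (htn n) (Y n) (hY n)
    have hc1 := Hc t ⟨by linarith, by linarith⟩
    set y := Y 0 + c * t + S x with hy
    have hyd : |y - (Y n + c * (t - -(n * τ)))| ≤ K3 * e := by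
      rwa [hy, show Y 0 + c * t + S x - (Y n + c * (t - -(n * τ)))
        = S x - (Y n - Y 0 + n * (c * τ)) by ring]
    have hmv := HV 0 _ _ (hu.hk h0 ht) y (Y n + c * (t - -(n * τ))) (hyd.trans he1)
    have hsq : (y - (Y n + c * (t - -(n * τ)))) ^ 2 ≤ (K3 * e) ^ 2 := by
      rw [← sq_abs]; exact pow_le_pow_left₀ (abs_nonneg _) hyd 2
    have hfin : NN c (wt u t) (wd u t) y ≤ (G * e) ^ 2 := by
      have h1 := mul_le_mul_of_nonneg_left hsq hV.le
      have h2 : (G * e) ^ 2 = 2 * (K2 * e) ^ 2 + V * (K3 * e) ^ 2 := by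
        rw [mul_pow, hG2]; ring
      linarith
    have hle := (half_le hc hu h0 ht y).trans hfin
    have heq : ∫ x' in Iio (0 : ℝ), ((u x' t - Qsol c (x' - (L + Y 0 + c * t + S x) + L)) ^ 2
        + (deriv (fun y => u y t) x' - deriv (Qsol c) (x' - (L + Y 0 + c * t + S x) + L)) ^ 2)
        = ∫ x in Iio (0:ℝ), ((u x t - Qsol c (x - y)) ^ 2 + (px u x t - qd c (x - y)) ^ 2) := by
      rw [Qsol_deriv]
      refine setIntegral_congr_fun measurableSet_Iio fun x' _ => ?_
      rw [show x' - (L + Y 0 + c * t + S x) + L = x' - y by rw [hy]; ring]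
      rfl
    simp only
    rw [heq]
    have h3 := Real.sqrt_le_sqrt hle
    rw [Real.sqrt_sq (by positivity)] at h3
    have h4 : G * e = G * K * ε := by rw [he]; ring
    linarith
  · intro t ht
    have hd1 : HasDerivAt S (deriv S (-t / τ)) (-t / τ) :=
      (hS.differentiable (by simp) _).hasDerivAt
    have hd2 : HasDerivAt (fun t : ℝ => -t / τ) (-1 / τ) t := (hasDerivAt_neg t).div_const τ
    have hd3 := hd1.comp t hd2
    have hd4 : HasDerivAt (fun t : ℝ => L + Y 0 + c * t) c t := by
      simpa using ((hasDerivAt_id t).const_mul c).const_add (L + Y 0)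
    have hd5 := (hd4.add hd3).deriv
    have hd6 : deriv (fun t => L + Y 0 + c * t + S (-t / τ)) t = c + deriv S (-t / τ) * (-1 / τ) := hd5
    rw [hd6, add_sub_cancel_left, abs_mul, abs_div, abs_neg, abs_one, abs_of_pos hτ]
    have h1 := mul_le_mul_of_nonneg_right (hSd (-t / τ)) (by positivity : 0 ≤ 1 / τ)
    have h2 : D * (K3 * e) * (1 / τ) = D * K3 * K / τ * ε := by rw [he]; field_simp
    have h3 : 0 ≤ D * K3 * K / τ := by positivity
    have h4 : (D * K3 * K / τ + 1) * 1 ≤ (D * K3 * K / τ + 1) * (G * K + 1) :=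
      mul_le_mul_of_nonneg_left (by nlinarith [mul_nonneg hG0 hK.le]) (by linarith)
    have h5 := mul_le_mul_of_nonneg_right h4 hεp.le
    linarith
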